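/- arXiv:1308.0621 — 9 statements merged into one kernel-verified Lean document; each statement's English description precedes it below -/
import Mathlib

section
/- Let n ≥ 1, let G be a subgroup of Sym(n), let C ⊆ G be a clique and S ⊆ G an independent set in the derangement graph Γ_G with |C|·|S| = |G|. Then for every irreducible complex character χ of G other than the trivial character, (v_C^⊤ E_χ v_C)·(v_S^⊤ E_χ v_S) = 0, where v_C, v_S ∈ {0,1}^G are the characteristic vectors of C and S, and E_χ is the |G|×|G| complex matrix with (π,σ)-entry (χ(1)/|G|)·χ(π^{-1}σ). -/
open Matrix

open CategoryTheory in
/-- A subspace of a simple representation that is stable under the action is trivial. -/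
theorem FDRep.eq_bot_or_eq_top_of_simple {k G : Type*} [Field k] [Monoid G]
    (V : FDRep k G) [Simple V] (W : Submodule k V)
    (hW : ∀ g, ∀ v ∈ W, V.ρ g v ∈ W) : W = ⊥ ∨ W = ⊤ := by
  let R : Subrepresentation (V.ρ : Representation k G V) := ⟨W, fun g v hv => hW g v hv⟩
  let f : FDRep.of R.toRepresentation ⟶ V :=
    ⟨InducedCategory.homMk (ModuleCat.ofHom W.subtype), fun g => by ext x; rfl⟩
  have hf : ∀ w : W, f.hom.hom.hom w = (w : V) := fun _ => rfl
  have hmono : Mono f := ConcreteCategory.mono_of_injective f Subtype.val_injective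
  by_cases h : f = 0
  · left
    refine (Submodule.eq_bot_iff _).2 fun w hw => ?_
    have hw0 := hf ⟨w, hw⟩
    rw [h] at hw0
    exact hw0.symm
  · right
    have : IsIso f := isIso_of_mono_of_nonzero h
    refine (Submodule.eq_top_iff').2 fun v => ?_
    obtain ⟨w, hw⟩ := (FDRep.isoToLinearEquiv (asIso f)).surjective v
    have hwv : ((w : W) : V) = v := hw
    exact hwv ▸ w.2

/-- In a simple representation with nontrivial character, only zero is fixed by every element. -/
theorem FDRep.eq_zero_of_forall_apply_eq {k G : Type*} [Field k] [Group G]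
    (V : FDRep k G) [CategoryTheory.Simple V] (hV : V.character ≠ fun _ => 1)
    {v : V} (hv : ∀ g, V.ρ g v = v) : v = 0 := by
  by_contra hv0
  have hW : ∀ w ∈ Submodule.span k {v}, ∀ g, V.ρ g w = w := by
    intro w hw g
    obtain ⟨a, rfl⟩ := Submodule.mem_span_singleton.1 hw
    rw [map_smul, hv]
  have htop : Submodule.span k {v} = ⊤ := by
    refine (V.eq_bot_or_eq_top_of_simple _ fun g w hw => ?_).resolve_left fun h =>
      hv0 (Submodule.span_singleton_eq_bot.1 h)
    rwa [hW w hw g]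
  have hone : ∀ g, V.ρ g = 1 := fun g =>
    LinearMap.ext fun w => hW w (htop ▸ Submodule.mem_top) g
  refine hV (funext fun g => ?_)
  have hrank : Module.finrank k V = 1 := by
    rw [← finrank_top, ← htop, finrank_span_singleton hv0]
  rw [FDRep.character, hone, LinearMap.trace_one, hrank, Nat.cast_one]

/-- The group sum acts as zero on a simple representation with nontrivial character. -/
theorem FDRep.sum_ρ_eq_zero {k G : Type*} [Field k] [Group G] [Fintype G]
    (V : FDRep k G) [CategoryTheory.Simple V] (hV : V.character ≠ fun _ => 1) :
    ∑ g, V.ρ g = 0 := by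
  refine LinearMap.ext fun v => V.eq_zero_of_forall_apply_eq hV fun h => ?_
  rw [← Module.End.mul_apply, Finset.mul_sum]
  simp_rw [← map_mul]
  exact LinearMap.congr_fun (Equiv.sum_comp (Equiv.mulLeft h) fun g => V.ρ g) v

/-- If `a ∘ ρ(g) ∘ b = 0` for every `g`, then `a = 0` or `b = 0` in a simple representation. -/
theorem FDRep.eq_zero_or_eq_zero_of_mul_ρ_mul {k G : Type*} [Field k] [Monoid G]
    (V : FDRep k G) [CategoryTheory.Simple V] {a b : V →ₗ[k] V}
    (hab : ∀ g, a * V.ρ g * b = 0) : a = 0 ∨ b = 0 := by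
  let W : Submodule k V := ⨅ g, LinearMap.ker (a * V.ρ g)
  have hmem : ∀ v, v ∈ W ↔ ∀ g, a (V.ρ g v) = 0 := fun v => by
    simp [W, Submodule.mem_iInf]
  rcases V.eq_bot_or_eq_top_of_simple W fun h v hv => (hmem _).2 fun g => by
      rw [← Module.End.mul_apply (V.ρ g), ← map_mul]
      exact (hmem v).1 hv _ with h | h
  · refine .inr (LinearMap.ext fun v => (Submodule.mem_bot k).1 ?_)
    rw [← h]
    exact (hmem _).2 fun g => LinearMap.congr_fun (hab g) v
  · refine .inl (LinearMap.ext fun v => ?_)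
    simpa using (hmem v).1 (h ▸ Submodule.mem_top) 1

theorem FDRep.sum_character_inv_mul {k G : Type*} [Field k] [Group G] (V : FDRep k G)
    (A : Finset G) :
    ∑ π ∈ A, ∑ σ ∈ A, V.character (π⁻¹ * σ) =
      LinearMap.trace k V ((∑ π ∈ A, V.ρ π⁻¹) * ∑ σ ∈ A, V.ρ σ) := by
  simp only [Finset.sum_mul_sum, map_sum, FDRep.character, map_mul]

/-- If every double translate `A g B⁻¹` covers the group exactly once, then one of the sums over
`A` and `B⁻¹` acts as zero on each simple representation with nontrivial character. -/
theorem FDRep.sum_ρ_eq_zero_or_of_bijective {k G : Type*} [Field k] [Group G] [Fintype G]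
    (V : FDRep k G) [CategoryTheory.Simple V] (hV : V.character ≠ fun _ => 1) (A B : Finset G)
    (hAB : ∀ g, Function.Bijective fun p : A × B => (p.1 : G) * g * (p.2 : G)⁻¹) :
    ∑ π ∈ A, V.ρ π = 0 ∨ ∑ σ ∈ B, V.ρ σ⁻¹ = 0 := by
  refine V.eq_zero_or_eq_zero_of_mul_ρ_mul fun g => ?_
  rw [← V.sum_ρ_eq_zero hV, ← (Equiv.ofBijective _ (hAB g)).sum_comp, Fintype.sum_prod_type,
    Finset.sum_mul, Finset.sum_mul_sum, ← Finset.sum_coe_sort A]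
  refine Finset.sum_congr rfl fun π _ => ?_
  rw [← Finset.sum_coe_sort B]
  simp only [Equiv.ofBijective_apply, map_mul]

/-- Translates of a clique and of an intersecting set multiply injectively. -/
theorem injective_mul_mul_inv_of_clique_of_intersecting {α : Type*}
    {G : Subgroup (Equiv.Perm α)} {C S : Finset G}
    (hC : ∀ π ∈ C, ∀ σ ∈ C, π ≠ σ → ∀ x : α, ((π * σ⁻¹ : G) : Equiv.Perm α) x ≠ x)
    (hS : ∀ π ∈ S, ∀ σ ∈ S, ∃ x : α, ((π * σ⁻¹ : G) : Equiv.Perm α) x = x) (g : G) :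
    Function.Injective fun p : C × S => (p.1 : G) * g * (p.2 : G)⁻¹ := by
  rintro ⟨⟨π, hπ⟩, ⟨τ, hτ⟩⟩ ⟨⟨σ, hσ⟩, ⟨ρ, hρ⟩⟩ h
  replace h : π * g * τ⁻¹ = σ * g * ρ⁻¹ := h
  have hπσ : π = σ := by
    by_contra hne
    obtain ⟨x, hx⟩ := hS τ hτ ρ hρ
    have hconj : π * σ⁻¹ * (σ * g * ρ⁻¹) = σ * g * ρ⁻¹ * (τ * ρ⁻¹) := by
      rw [← h]
      nth_rewrite 1 [h]
      group
    refine hC π hπ σ hσ hne (((σ * g * ρ⁻¹ : G) : Equiv.Perm α) x) ?_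
    rw [← Equiv.Perm.mul_apply, ← Subgroup.coe_mul, hconj, Subgroup.coe_mul,
      Equiv.Perm.mul_apply, hx]
  subst hπσ
  simp_all

open Matrix

/-- **Equality in the clique–coclique bound.**
If `C` is a clique and `S` an independent set in the derangement graph of
`G ≤ Sym(n)` with `|C|·|S| = |G|`, then for every irreducible complex character
`χ` of `G` other than the trivial character,
`(v_C^⊤ E_χ v_C)·(v_S^⊤ E_χ v_S) = 0`, where `E_χ` has `(π,σ)`-entry
`(χ(1)/|G|)·χ(π⁻¹σ)`. -/
theorem clique_coclique_equality_projections {n : ℕ} (hn : 1 ≤ n)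
    (G : Subgroup (Equiv.Perm (Fin n))) [Fintype G] [DecidableEq G]
    (C S : Finset G)
    (hC : ∀ π ∈ C, ∀ σ ∈ C, π ≠ σ →
      ∀ x : Fin n, ((π * σ⁻¹ : G) : Equiv.Perm (Fin n)) x ≠ x)
    (hS : ∀ π ∈ S, ∀ σ ∈ S,
      ∃ x : Fin n, ((π * σ⁻¹ : G) : Equiv.Perm (Fin n)) x = x)
    (hcard : C.card * S.card = Fintype.card G)
    (V : FDRep ℂ G) (hsimple : CategoryTheory.Simple V)
    (htriv : V.character ≠ fun _ => 1) :
    let E : Matrix G G ℂ :=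
      fun π σ => (V.character 1 / (Fintype.card G : ℂ)) * V.character (π⁻¹ * σ)
    let vC : G → ℂ := fun g => if g ∈ C then 1 else 0
    let vS : G → ℂ := fun g => if g ∈ S then 1 else 0
    (vC ⬝ᵥ E.mulVec vC) * (vS ⬝ᵥ E.mulVec vS) = 0 := by
  intro E vC vS
  have hE : ∀ A : Finset G, (fun g => if g ∈ A then (1 : ℂ) else 0) ⬝ᵥ
      E.mulVec (fun g => if g ∈ A then 1 else 0) = V.character 1 / (Fintype.card G : ℂ) *
        LinearMap.trace ℂ V ((∑ π ∈ A, V.ρ π⁻¹) * ∑ σ ∈ A, V.ρ σ) := by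
    intro A
    rw [← FDRep.sum_character_inv_mul]
    simp [dotProduct, mulVec, E, Finset.mul_sum]
  have hbij : ∀ g, Function.Bijective fun p : C × S => (p.1 : G) * g * (p.2 : G)⁻¹ := fun g =>
    (Fintype.bijective_iff_injective_and_card _).2
      ⟨injective_mul_mul_inv_of_clique_of_intersecting hC hS g, by simpa using hcard⟩
  rw [hE C, hE S]
  rcases V.sum_ρ_eq_zero_or_of_bijective htriv C S hbij with h | h <;> simp [h]
end

section
/- Let n ≥ 2 and let G be a 2-transitive subgroup of Sym(n). If there exists a subset T ⊆ G with |T| = n that is a clique in the derangement graph Γ_G (equivalently, T is a sharply transitive set: for all i,j ∈ [n] there is exactly one t ∈ T with t(i) = j), then G has the EKR property: every intersecting subset S ⊆ G satisfies |S| ≤ |G|/n. -/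
/-- If a 2-transitive subgroup `G ≤ Sym(n)` contains a sharply transitive set
(a clique of size `n` in the derangement graph), then `G` has the EKR property:
every intersecting subset `S ⊆ G` satisfies `|S| ≤ |G|/n`. -/
theorem ekr_of_sharply_transitive_set {n : ℕ} (hn : 2 ≤ n)
    (G : Subgroup (Equiv.Perm (Fin n))) [Fintype G]
    (h2t : ∀ a b c d : Fin n, a ≠ b → c ≠ d →
      ∃ g : G, (g : Equiv.Perm (Fin n)) a = c ∧ (g : Equiv.Perm (Fin n)) b = d)
    (T : Finset G) (hTcard : T.card = n)
    (hT : ∀ π ∈ T, ∀ σ ∈ T, π ≠ σ →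
      ∀ x : Fin n, ((π * σ⁻¹ : G) : Equiv.Perm (Fin n)) x ≠ x) :
    ∀ S : Finset G,
      (∀ π ∈ S, ∀ σ ∈ S, ∃ x : Fin n, ((π * σ⁻¹ : G) : Equiv.Perm (Fin n)) x = x) →
      (S.card : ℝ) ≤ (Fintype.card G : ℝ) / n := by
  intro S hS
  have hinj : Set.InjOn (fun p : G × G => p.1⁻¹ * p.2) (S ×ˢ T : Finset (G × G)) := by
    rintro ⟨s, t⟩ hp ⟨s', t'⟩ hp' h
    simp only [Finset.coe_product, Set.mem_prod, Finset.mem_coe] at hp hp' h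
    have key : s' * s⁻¹ = t' * t⁻¹ := by
      rw [eq_mul_inv_iff_mul_eq, mul_assoc, h, mul_inv_cancel_left]
    obtain rfl : t' = t := by
      by_contra hne
      obtain ⟨x, hx⟩ := hS s' hp'.1 s hp.1
      rw [key] at hx
      exact hT t' hp'.2 t hp.2 hne x hx
    rw [mul_inv_cancel, mul_inv_eq_one] at key
    rw [key]
  have hcard : S.card * T.card ≤ Fintype.card G := by
    rw [← Finset.card_product, ← Finset.card_univ]
    exact Finset.card_le_card_of_injOn _ (fun _ _ => Finset.mem_univ _) hinj
  rw [hTcard] at hcard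
  rw [le_div_iff₀ (by positivity)]
  exact_mod_cast hcard
end

section
/- Let X be a k-regular graph on N ≥ 1 vertices with at least one edge, let A be the adjacency matrix of X, and let τ be the least eigenvalue of A (so τ < 0). Then every independent set S of X satisfies |S| ≤ N·(−τ)/(k − τ), i.e., |S| ≤ N/(1 − k/τ). -/
open Matrix in
/-- The Rayleigh quotient of a real symmetric matrix is bounded below by any lower bound of its
eigenvalues. -/
theorem Matrix.IsSymm.mul_dotProduct_self_le {n : Type*} [Fintype n] {A : Matrix n n ℝ}
    (hA : A.IsSymm) {τ : ℝ}
    (hmin : ∀ μ : ℝ, (∃ v : n → ℝ, v ≠ 0 ∧ A *ᵥ v = μ • v) → τ ≤ μ) (x : n → ℝ) :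
    τ * (x ⬝ᵥ x) ≤ x ⬝ᵥ A *ᵥ x := by
  classical
  have hB : (A - τ • (1 : Matrix n n ℝ)).IsHermitian := by
    simp [IsHermitian, conjTranspose_eq_transpose_of_trivial, hA.eq]
  have hpos : (A - τ • (1 : Matrix n n ℝ)).PosSemidef := by
    refine hB.posSemidef_iff_eigenvalues_nonneg.mpr fun i => ?_
    have hv := hB.mulVec_eigenvectorBasis i
    rw [sub_mulVec, smul_mulVec, one_mulVec, sub_eq_iff_eq_add, ← add_smul] at hv
    have hne : (hB.eigenvectorBasis i).ofLp ≠ 0 := fun h =>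
      hB.eigenvectorBasis.orthonormal.ne_zero i (by ext j; exact congrFun h j)
    have := hmin _ ⟨_, hne, hv⟩
    simpa using this
  have h := hpos.dotProduct_mulVec_nonneg x
  rw [sub_mulVec, smul_mulVec, one_mulVec, dotProduct_sub, dotProduct_smul, star_trivial,
    smul_eq_mul] at h
  linarith

/-- **The ratio bound (Delsarte–Hoffman bound).**
If `X` is a `k`-regular graph on `N` vertices with at least one edge, `τ` is the
least eigenvalue of its adjacency matrix, and `S` is an independent set of `X`,
then `|S| ≤ N·(−τ)/(k − τ)`. -/
theorem ratio_bound {V : Type*} [Fintype V] (hV : 1 ≤ Fintype.card V)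
    (X : SimpleGraph V) [DecidableRel X.Adj] (k : ℕ)
    (hreg : X.IsRegularOfDegree k)
    (hedge : ∃ u v : V, X.Adj u v) (τ : ℝ)
    (hτ : ∃ v : V → ℝ, v ≠ 0 ∧ (X.adjMatrix ℝ).mulVec v = τ • v)
    (hmin : ∀ μ : ℝ, (∃ v : V → ℝ, v ≠ 0 ∧ (X.adjMatrix ℝ).mulVec v = μ • v) → τ ≤ μ)
    (S : Finset V) (hS : ∀ u ∈ S, ∀ w ∈ S, ¬ X.Adj u w) :
    (S.card : ℝ) ≤ (Fintype.card V : ℝ) * (-τ) / (k - τ) := by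
  classical
  have key := (X.isSymm_adjMatrix (α := ℝ)).mul_dotProduct_self_le hmin
  have hτ_neg : τ < 0 := by
    obtain ⟨u, v, huv⟩ := hedge
    have h := key (Pi.single u 1 - Pi.single v 1)
    simp [Matrix.mulVec_sub, sub_dotProduct, dotProduct_sub, huv, huv.symm, huv.ne,
      huv.ne.symm] at h
    linarith
  set f : V → ℝ := fun v => if v ∈ S then 1 else 0
  have hA1 : (X.adjMatrix ℝ).mulVec 1 = (k : ℝ) • 1 := by
    ext v
    simp [SimpleGraph.adjMatrix_mulVec_apply, hreg.degree_eq v]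
  have hff : f ⬝ᵥ f = S.card := by simp [f, dotProduct]
  have hf1 : f ⬝ᵥ 1 = S.card := by simp [f, dotProduct]
  have h1f : 1 ⬝ᵥ f = (S.card : ℝ) := by rw [dotProduct_comm, hf1]
  have hfAf : f ⬝ᵥ (X.adjMatrix ℝ).mulVec f = 0 := by
    rw [SimpleGraph.dotProduct_mulVec_adjMatrix]
    refine Finset.sum_eq_zero fun u _ => Finset.sum_eq_zero fun w _ => ?_
    have := hS u
    simp only [f]
    grind
  have h1Af : 1 ⬝ᵥ (X.adjMatrix ℝ).mulVec f = k * S.card := by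
    rw [Matrix.dotProduct_mulVec, ← Matrix.mulVec_transpose, SimpleGraph.transpose_adjMatrix, hA1,
      smul_dotProduct, h1f, smul_eq_mul]
  have h11 : (1 : V → ℝ) ⬝ᵥ 1 = Fintype.card V := by simp
  have h := key ((Fintype.card V : ℝ) • f - (S.card : ℝ) • 1)
  simp only [Matrix.mulVec_sub, Matrix.mulVec_smul, sub_dotProduct, dotProduct_sub,
    smul_dotProduct, dotProduct_smul, hA1, hff, hf1, h1f, hfAf, h1Af, h11, smul_eq_mul] at h
  have hN : (0 : ℝ) < Fintype.card V := by exact_mod_cast hV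
  rw [le_div_iff₀ (sub_pos.mpr (hτ_neg.trans_le k.cast_nonneg))]
  rcases S.card.eq_zero_or_pos with hs | hs
  · rw [hs, Nat.cast_zero, zero_mul]
    exact mul_nonneg hN.le (neg_nonneg.mpr hτ_neg.le)
  · have hs' : (0 : ℝ) < S.card := by exact_mod_cast hs
    refine le_of_mul_le_mul_left ?_ (mul_pos hN hs')
    linarith
end

section
/- Let n ≥ 2 and let G be a 2-transitive subgroup of Sym(n). Then −|D_G|/(n−1) is an eigenvalue of the adjacency matrix of the derangement graph Γ_G. -/
open Matrix

section TwoTransitive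

variable {G α : Type*} [Group G] [MulAction G α] [DecidableEq α]

/-- If `D` is closed under conjugation, the number of `d ∈ D` sending `x` to `y` only depends on
the orbit of `(x, y)`. -/
theorem card_filter_smul_eq_of_conj {D : Finset G}
    (hD : ∀ g : G, ∀ d ∈ D, g * d * g⁻¹ ∈ D) (g : G) (x y : α) :
    (D.filter fun d => d • (g • x) = g • y).card = (D.filter fun d => d • x = y).card := by
  refine Finset.card_bij' (fun d _ => g⁻¹ * d * g) (fun d _ => g * d * g⁻¹) ?_ ?_ ?_ ?_
  · intro d hd
    rw [Finset.mem_filter] at hd ⊢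
    refine ⟨by simpa using hD g⁻¹ d hd.1, ?_⟩
    rw [mul_smul, mul_smul, hd.2, inv_smul_smul]
  · intro d hd
    rw [Finset.mem_filter] at hd ⊢
    refine ⟨hD g d hd.1, ?_⟩
    rw [mul_smul, mul_smul, inv_smul_smul, hd.2]
  · intro d _
    group
  · intro d _
    group

/-- For a 2-transitive action, each pair of distinct points `x, y` is matched by the same number
`|D| / (|α| - 1)` of elements of a conjugation-closed set `D` of derangements. -/
theorem card_filter_smul_eq_mul_card_sub_one [Fintype α] {D : Finset G}
    (hD : ∀ g : G, ∀ d ∈ D, g * d * g⁻¹ ∈ D) (hfix : ∀ d ∈ D, ∀ x : α, d • x ≠ x)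
    (h2t : ∀ a b c d : α, a ≠ b → c ≠ d → ∃ g : G, g • a = c ∧ g • b = d)
    {x y : α} (hxy : x ≠ y) :
    (D.filter fun d => d • x = y).card * (Fintype.card α - 1) = D.card := by
  have hmaps : ∀ d ∈ D, d • x ∈ Finset.univ.erase x := fun d hd => by simp [hfix d hd x]
  rw [Finset.card_eq_sum_card_fiberwise hmaps,
    Finset.sum_const_nat (m := (D.filter fun d => d • x = y).card), Finset.card_erase_of_mem
      (Finset.mem_univ x), Finset.card_univ, mul_comm]
  intro z hz
  obtain ⟨g, hgx, hgy⟩ := h2t x y x z hxy (Finset.ne_of_mem_erase hz).symm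
  simpa [hgx, hgy] using card_filter_smul_eq_of_conj hD g x y

end TwoTransitive

/-- The action of the adjacency matrix of a Cayley graph on a function. -/
theorem cayley_mulVec_apply {G : Type*} [Group G] [Fintype G] [DecidableEq G] (D : Finset G)
    (v : G → ℝ) (π : G) :
    ((fun π σ => if π * σ⁻¹ ∈ D then 1 else 0 : Matrix G G ℝ) *ᵥ v) π =
      ∑ d ∈ D, v (d⁻¹ * π) := by
  simp only [mulVec, dotProduct, ite_mul, one_mul, zero_mul]
  rw [← Equiv.sum_comp ((Equiv.inv G).trans (Equiv.mulRight π))]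
  simp [Finset.sum_ite_mem]

/-- For a 2-transitive subgroup `G ≤ Sym(n)` with `n ≥ 2`, the number
`−|D_G|/(n−1)` is an eigenvalue of the adjacency matrix of the derangement
graph of `G`. -/
theorem standard_eigenvalue_of_derangement_graph {n : ℕ} (hn : 2 ≤ n)
    (G : Subgroup (Equiv.Perm (Fin n))) [Fintype G]
    (h2t : ∀ a b c d : Fin n, a ≠ b → c ≠ d →
      ∃ g : G, (g : Equiv.Perm (Fin n)) a = c ∧ (g : Equiv.Perm (Fin n)) b = d) :
    let D : Finset G := Finset.univ.filter fun g => ∀ x, (g : Equiv.Perm (Fin n)) x ≠ x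
    let A : Matrix G G ℝ := fun π σ => if (π * σ⁻¹ : G) ∈ D then 1 else 0
    ∃ v : G → ℝ, v ≠ 0 ∧ A.mulVec v = (-(D.card : ℝ) / ((n : ℝ) - 1)) • v := by
  intro D A
  have hmem : ∀ g : G, g ∈ D ↔ ∀ x : Fin n, g • x ≠ x := fun g => by
    simp [D, Subgroup.smul_def]
  have hD : ∀ g : G, ∀ d ∈ D, g * d * g⁻¹ ∈ D := by
    intro g d hd
    rw [hmem] at hd ⊢
    intro x hx
    apply hd (g⁻¹ • x)
    rwa [mul_smul, mul_smul, smul_eq_iff_eq_inv_smul] at hx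
  have hn' : (2 : ℝ) ≤ n := by exact_mod_cast hn
  have hn0 : (n : ℝ) ≠ 0 := by linarith
  have hn1 : (n : ℝ) - 1 ≠ 0 := by linarith
  let a : Fin n := ⟨0, by omega⟩
  refine ⟨fun σ => (if σ • a = a then 1 else 0) - 1 / (n : ℝ), ?_, ?_⟩
  · intro h
    have h1 := congrFun h 1
    simp only [one_smul, if_true, Pi.zero_apply] at h1
    field_simp at h1
    exact hn1 (by simpa using h1)
  · funext π
    have hsum := cayley_mulVec_apply D (fun σ => (if σ • a = a then 1 else 0) - 1 / (n : ℝ)) π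
    refine Eq.trans (by convert hsum) ?_
    have hcount : ∑ d ∈ D, (if (d⁻¹ * π) • a = a then (1 : ℝ) else 0) =
        (D.filter fun d => d • a = π • a).card := by
      rw [Finset.sum_boole]
      simp only [mul_smul, inv_smul_eq_iff, eq_comm (a := π • a)]
    rw [Finset.sum_sub_distrib, hcount, Finset.sum_const, nsmul_eq_mul, Pi.smul_apply,
      smul_eq_mul]
    by_cases hπ : π • a = a
    · have hempty : (D.filter fun d => d • a = π • a) = ∅ :=
        Finset.filter_eq_empty_iff.2 fun d hd => by
          rw [hπ]
          exact (hmem d).1 hd a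
      rw [hempty, if_pos hπ]
      simp only [Finset.card_empty, Nat.cast_zero]
      field_simp
      ring
    · have hcard := card_filter_smul_eq_mul_card_sub_one hD (fun d hd => (hmem d).1 hd) h2t
        (Ne.symm hπ)
      rw [Fintype.card_fin] at hcard
      have hcard' : ((D.filter fun d => d • a = π • a).card : ℝ) * ((n : ℝ) - 1) = D.card := by
        rw [← hcard]
        push_cast [Nat.cast_sub (show 1 ≤ n by omega)]
        ring
      rw [if_neg hπ, ← hcard']
      field_simp
      ring
end

section
/- Let n ≥ 2 and let G be a 2-transitive subgroup of Sym(n). Then the (n−1)² vectors {v_{i,j} − (1/n)·1 : i,j ∈ [n−1]} are linearly independent in ℝ^G, and they form a basis of the standard module of G, i.e., of the column space of the matrix E with entries E_{π,σ} = ((n−1)/|G|)·(fix(π^{-1}σ) − 1). -/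
open Matrix

/-- The characteristic vector of the canonical set of all `g ∈ G` with `g i = j`. -/
noncomputable def canonicalVector {n : ℕ} (G : Subgroup (Equiv.Perm (Fin n))) (i j : Fin n) :
    G → ℝ :=
  fun g => if (g : Equiv.Perm (Fin n)) i = j then 1 else 0

section canonicalVector

variable {n : ℕ} {G : Subgroup (Equiv.Perm (Fin n))}

theorem sum_canonicalVector_right (i : Fin n) (g : G) : ∑ j, canonicalVector G i j g = 1 := by
  simp [canonicalVector]

theorem sum_canonicalVector_left (j : Fin n) (g : G) : ∑ i, canonicalVector G i j g = 1 := by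
  simp only [canonicalVector, ← Equiv.eq_symm_apply]
  simp

theorem canonicalVector_mul_left (i j : Fin n) (h g : G) :
    canonicalVector G i ((h : Equiv.Perm (Fin n)) j) (h * g) = canonicalVector G i j g := by
  simp [canonicalVector]

theorem canonicalVector_mul_eq_zero {k i l j : Fin n} (h : ¬(k = i ↔ l = j)) (g : G) :
    canonicalVector G k l g * canonicalVector G i j g = 0 := by
  simp only [canonicalVector, mul_ite, mul_one, mul_zero, ite_eq_right_iff, one_ne_zero, imp_false]
  rintro rfl rfl
  exact h (EmbeddingLike.apply_eq_iff_eq _).symm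

theorem card_filter_inv_mul_fixed (π σ : G) :
    ((Finset.univ.filter fun x : Fin n =>
      ((π⁻¹ * σ : G) : Equiv.Perm (Fin n)) x = x).card : ℝ) =
      ∑ i, ∑ j, canonicalVector G i j π * canonicalVector G i j σ := by
  simp only [canonicalVector, mul_ite, mul_one, mul_zero, Finset.sum_ite_eq, Finset.mem_univ,
    if_true, Finset.card_filter, Nat.cast_sum, Nat.cast_ite, Nat.cast_one, Nat.cast_zero]
  refine Finset.sum_congr rfl fun x _ => ?_
  simp [Equiv.symm_apply_eq, eq_comm (a := (σ : Equiv.Perm (Fin n)) x)]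

variable [Fintype G]

/-- The number of elements of a 2-transitive group mapping a pair of distinct points to a given
pair of distinct points. -/
theorem sum_canonicalVector_mul_of_ne (hn : 2 ≤ n)
    (h2t : ∀ a b c d : Fin n, a ≠ b → c ≠ d →
      ∃ g : G, (g : Equiv.Perm (Fin n)) a = c ∧ (g : Equiv.Perm (Fin n)) b = d)
    {k i l j : Fin n} (hki : k ≠ i) (hlj : l ≠ j) :
    ∑ g, canonicalVector G k l g * canonicalVector G i j g =
      Fintype.card G / (n * (n - 1) : ℝ) := by
  set m := ∑ g, canonicalVector G k l g * canonicalVector G i j g with hm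
  have hF (l' j' : Fin n) :
      ∑ g, canonicalVector G k l' g * canonicalVector G i j' g = m - if l' = j' then m else 0 := by
    split_ifs with h
    · rw [sub_self]
      exact Finset.sum_eq_zero fun g _ => canonicalVector_mul_eq_zero (by simp [hki, h]) g
    · obtain ⟨x, rfl, rfl⟩ := h2t l j l' j' hlj h
      rw [← Equiv.sum_comp (Equiv.mulLeft x)]
      simp [canonicalVector_mul_left, hm]
  have htotal : ∑ l', ∑ j', ∑ g, canonicalVector G k l' g * canonicalVector G i j' g =
      Fintype.card G := by
    have h (l' : Fin n) : ∑ j', ∑ g, canonicalVector G k l' g * canonicalVector G i j' g =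
        ∑ g, canonicalVector G k l' g := by
      rw [Finset.sum_comm]
      simp [← Finset.mul_sum, sum_canonicalVector_right]
    simp_rw [h]
    rw [Finset.sum_comm]
    simp [sum_canonicalVector_right]
  simp only [hF, Finset.sum_sub_distrib, Finset.sum_ite_eq, Finset.mem_univ, if_true,
    Finset.sum_const, Finset.card_univ, Fintype.card_fin, nsmul_eq_mul] at htotal
  have hn' : (2 : ℝ) ≤ n := by exact_mod_cast hn
  rw [eq_div_iff (by nlinarith)]
  linarith

theorem sum_canonicalVector (hn : 2 ≤ n)
    (h2t : ∀ a b c d : Fin n, a ≠ b → c ≠ d →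
      ∃ g : G, (g : Equiv.Perm (Fin n)) a = c ∧ (g : Equiv.Perm (Fin n)) b = d)
    (k l : Fin n) : ∑ g, canonicalVector G k l g = Fintype.card G / (n : ℝ) := by
  have : Nontrivial (Fin n) := Fin.nontrivial_iff_two_le.mpr hn
  obtain ⟨i, hi⟩ := exists_ne k
  have hn' : (2 : ℝ) ≤ n := by exact_mod_cast hn
  have hF (j : Fin n) : ∑ g, canonicalVector G k l g * canonicalVector G i j g =
      Fintype.card G / (n * (n - 1) : ℝ) -
        if l = j then Fintype.card G / (n * (n - 1) : ℝ) else 0 := by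
    split_ifs with h
    · rw [sub_self]
      exact Finset.sum_eq_zero fun g _ => canonicalVector_mul_eq_zero (by simp [hi.symm, h]) g
    · rw [sum_canonicalVector_mul_of_ne hn h2t hi.symm h, sub_zero]
  calc ∑ g, canonicalVector G k l g
      = ∑ j, ∑ g, canonicalVector G k l g * canonicalVector G i j g := by
        rw [Finset.sum_comm]
        simp [← Finset.mul_sum, sum_canonicalVector_right]
    _ = Fintype.card G / (n : ℝ) := by
        simp only [hF, Finset.sum_sub_distrib, Finset.sum_ite_eq, Finset.mem_univ, if_true,
          Finset.sum_const, Finset.card_univ, Fintype.card_fin, nsmul_eq_mul]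
        have : (n : ℝ) - 1 ≠ 0 := by linarith
        field_simp

/-- The Gram matrix of the characteristic vectors of the canonical sets. -/
theorem sum_canonicalVector_mul (hn : 2 ≤ n)
    (h2t : ∀ a b c d : Fin n, a ≠ b → c ≠ d →
      ∃ g : G, (g : Equiv.Perm (Fin n)) a = c ∧ (g : Equiv.Perm (Fin n)) b = d)
    (k l i j : Fin n) :
    ∑ g, canonicalVector G k l g * canonicalVector G i j g =
      Fintype.card G / (n * (n - 1) : ℝ) *
        (1 - (if k = i then 1 else 0) - (if l = j then 1 else 0) +
          n * ((if k = i then 1 else 0) * if l = j then 1 else 0)) := by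
  have hn' : (2 : ℝ) ≤ n := by exact_mod_cast hn
  have hn1 : (n : ℝ) - 1 ≠ 0 := by linarith
  by_cases hki : k = i <;> by_cases hlj : l = j
  · subst hki hlj
    have h : ∀ g, canonicalVector G k l g * canonicalVector G k l g = canonicalVector G k l g := by
      simp [canonicalVector]
    simp only [h, sum_canonicalVector hn h2t, if_true]
    field_simp
    ring
  · rw [Finset.sum_eq_zero fun g _ => canonicalVector_mul_eq_zero (by simp [hki, hlj]) g]
    simp [hki, hlj]
  · rw [Finset.sum_eq_zero fun g _ => canonicalVector_mul_eq_zero (by simp [hki, hlj]) g]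
    simp [hki, hlj]
  · rw [sum_canonicalVector_mul_of_ne hn h2t hki hlj]
    simp [hki, hlj]

/-- A relation between the centred canonical vectors that does not involve the row and the column
of one point `z` is trivial. -/
theorem eq_zero_of_sum_mul_canonicalVector_sub_eq_zero (hn : 2 ≤ n)
    (h2t : ∀ a b c d : Fin n, a ≠ b → c ≠ d →
      ∃ g : G, (g : Equiv.Perm (Fin n)) a = c ∧ (g : Equiv.Perm (Fin n)) b = d)
    {A : Fin n → Fin n → ℝ} {z : Fin n} (hrow : ∀ j, A z j = 0) (hcol : ∀ i, A i z = 0)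
    (hA : ∀ g : G, ∑ i, ∑ j, A i j * (canonicalVector G i j g - 1 / n) = 0) (k l : Fin n) :
    A k l = 0 := by
  have hn' : (2 : ℝ) ≤ n := by exact_mod_cast hn
  have hn0 : (n : ℝ) ≠ 0 := by linarith
  have hn1 : (n : ℝ) - 1 ≠ 0 := by linarith
  have hG : (Fintype.card G : ℝ) ≠ 0 := by exact_mod_cast Fintype.card_ne_zero
  have key (k l : Fin n) :
      (∑ i, ∑ j, A i j) / n - ∑ j, A k j - ∑ i, A i l + n * A k l = 0 := by
    have h0 : ∑ g, canonicalVector G k l g *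
        ∑ i, ∑ j, A i j * (canonicalVector G i j g - 1 / n) = 0 := by
      simp only [hA, mul_zero, Finset.sum_const_zero]
    have h1 : ∑ g, canonicalVector G k l g *
        ∑ i, ∑ j, A i j * (canonicalVector G i j g - 1 / n) =
        ∑ i, ∑ j, A i j * (∑ g, canonicalVector G k l g * canonicalVector G i j g -
          (∑ g, canonicalVector G k l g) / n) := by
      simp_rw [Finset.mul_sum]
      rw [Finset.sum_comm]
      refine Finset.sum_congr rfl fun i _ => ?_
      rw [Finset.sum_comm]
      refine Finset.sum_congr rfl fun j _ => ?_
      rw [Finset.sum_div, ← Finset.sum_sub_distrib, Finset.mul_sum]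
      exact Finset.sum_congr rfl fun g _ => by ring
    have h2 (i j : Fin n) :
        A i j * (∑ g, canonicalVector G k l g * canonicalVector G i j g -
          (∑ g, canonicalVector G k l g) / n) =
        Fintype.card G / (n * (n - 1) : ℝ) * (A i j / n - (if k = i then A i j else 0) -
          (if l = j then A i j else 0) + n * if k = i then if l = j then A i j else 0 else 0) := by
      rw [sum_canonicalVector_mul hn h2t, sum_canonicalVector hn h2t]
      split_ifs <;> field_simp <;> ring
    rw [h1] at h0
    simp_rw [h2, ← Finset.mul_sum] at h0
    have h3 := (mul_eq_zero.mp h0).resolve_left (div_ne_zero hG (mul_ne_zero hn0 hn1))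
    rw [← h3]
    simp only [Finset.sum_add_distrib, Finset.sum_sub_distrib, Finset.sum_div, ← Finset.mul_sum,
      Finset.sum_ite_eq, Finset.mem_univ, if_true, Finset.sum_ite_irrel, Finset.sum_const_zero]
  have hS : (∑ i, ∑ j, A i j) / n = 0 := by simpa [hrow, hcol] using key z z
  have hC (l : Fin n) : ∑ i, A i l = 0 := by simpa [hS, hrow] using key z l
  have hR (k : Fin n) : ∑ j, A k j = 0 := by simpa [hS, hcol] using key k z
  simpa [hS, hC, hR, hn0] using key k l

end canonicalVector

/-- The column space of `A * Aᵀ` is the column space of `A`, for real matrices. -/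
theorem Matrix.range_mulVecLin_self_mul_transpose {m n : Type*} [Fintype m] [Fintype n]
    (A : Matrix m n ℝ) :
    LinearMap.range (A * Aᵀ).mulVecLin = LinearMap.range A.mulVecLin := by
  refine Submodule.eq_of_le_of_finrank_eq ?_ A.rank_self_mul_transpose
  rw [Matrix.mulVecLin_mul]
  exact LinearMap.range_comp_le_range _ _

theorem sum_canonicalVector_sub_mul {n : ℕ} (hn : n ≠ 0) {G : Subgroup (Equiv.Perm (Fin n))}
    (π σ : G) :
    ∑ i, ∑ j, (canonicalVector G i j π - 1 / n) * (canonicalVector G i j σ - 1 / n) =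
      ∑ i, ∑ j, canonicalVector G i j π * canonicalVector G i j σ - 1 := by
  have hn0 : (n : ℝ) ≠ 0 := by exact_mod_cast hn
  simp only [sub_mul, mul_sub, Finset.sum_sub_distrib, ← Finset.mul_sum, ← Finset.sum_mul,
    sum_canonicalVector_right, Finset.sum_const, Finset.card_univ, Fintype.card_fin, nsmul_eq_mul]
  field_simp
  ring

theorem span_castSucc_canonicalVector_sub {m : ℕ} (G : Subgroup (Equiv.Perm (Fin (m + 1)))) :
    Submodule.span ℝ (Set.range fun p : Fin m × Fin m =>
      canonicalVector G p.1.castSucc p.2.castSucc - (1 / ((m + 1 : ℕ) : ℝ)) • fun _ => (1 : ℝ)) =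
    Submodule.span ℝ (Set.range fun p : Fin (m + 1) × Fin (m + 1) =>
      canonicalVector G p.1 p.2 - (1 / ((m + 1 : ℕ) : ℝ)) • fun _ => (1 : ℝ)) := by
  set u : Fin (m + 1) → Fin (m + 1) → G → ℝ := fun i j =>
    canonicalVector G i j - (1 / ((m + 1 : ℕ) : ℝ)) • fun _ => (1 : ℝ) with hu
  have hm : ((m + 1 : ℕ) : ℝ) ≠ 0 := by positivity
  have hrow (i : Fin (m + 1)) : ∑ j, u i j = 0 := by
    ext g
    simp only [hu, Finset.sum_apply, Pi.sub_apply, Pi.smul_apply, Finset.sum_sub_distrib,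
      sum_canonicalVector_right, Finset.sum_const, Finset.card_univ, Fintype.card_fin,
      nsmul_eq_mul, smul_eq_mul, Pi.zero_apply]
    field_simp
    ring
  have hcol (j : Fin (m + 1)) : ∑ i, u i j = 0 := by
    ext g
    simp only [hu, Finset.sum_apply, Pi.sub_apply, Pi.smul_apply, Finset.sum_sub_distrib,
      sum_canonicalVector_left, Finset.sum_const, Finset.card_univ, Fintype.card_fin,
      nsmul_eq_mul, smul_eq_mul, Pi.zero_apply]
    field_simp
    ring
  apply le_antisymm
  · refine Submodule.span_mono ?_
    rintro _ ⟨p, rfl⟩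
    exact ⟨(p.1.castSucc, p.2.castSucc), rfl⟩
  · rw [Submodule.span_le]
    set W := Submodule.span ℝ (Set.range fun p : Fin m × Fin m => u p.1.castSucc p.2.castSucc)
    have h1 (i j : Fin m) : u i.castSucc j.castSucc ∈ W := Submodule.subset_span ⟨(i, j), rfl⟩
    have h2 (i : Fin m) (j : Fin (m + 1)) : u i.castSucc j ∈ W := by
      induction j using Fin.lastCases with
      | cast j => exact h1 i j
      | last =>
        have h := hrow i.castSucc
        rw [Fin.sum_univ_castSucc] at h
        rw [eq_neg_of_add_eq_zero_right h]
        exact W.neg_mem (W.sum_mem fun j _ => h1 i j)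
    rintro _ ⟨⟨i, j⟩, rfl⟩
    change u i j ∈ W
    induction i using Fin.lastCases with
    | cast i => exact h2 i j
    | last =>
      have h := hcol j
      rw [Fin.sum_univ_castSucc] at h
      rw [eq_neg_of_add_eq_zero_right h]
      exact W.neg_mem (W.sum_mem fun i _ => h2 i j)

theorem linearIndependent_castSucc_canonicalVector_sub {m : ℕ} (hm : 2 ≤ m + 1)
    (G : Subgroup (Equiv.Perm (Fin (m + 1)))) [Fintype G]
    (h2t : ∀ a b c d : Fin (m + 1), a ≠ b → c ≠ d →
      ∃ g : G, (g : Equiv.Perm (Fin (m + 1))) a = c ∧ (g : Equiv.Perm (Fin (m + 1))) b = d) :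
    LinearIndependent ℝ fun p : Fin m × Fin m =>
      canonicalVector G p.1.castSucc p.2.castSucc -
        (1 / ((m + 1 : ℕ) : ℝ)) • fun _ => (1 : ℝ) := by
  rw [Fintype.linearIndependent_iff]
  rintro a ha ⟨k, l⟩
  let A : Fin (m + 1) → Fin (m + 1) → ℝ :=
    Fin.snoc (α := fun _ => Fin (m + 1) → ℝ)
      (fun i => Fin.snoc (α := fun _ => ℝ) (fun j => a (i, j)) 0) 0
  have hrow (j) : A (Fin.last m) j = 0 := by simp [A]
  have hcol (i) : A i (Fin.last m) = 0 := by
    induction i using Fin.lastCases <;> simp [A]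
  have hA (i j : Fin m) : A i.castSucc j.castSucc = a (i, j) := by simp [A]
  rw [← hA]
  refine eq_zero_of_sum_mul_canonicalVector_sub_eq_zero hm h2t hrow hcol (fun g => ?_) _ _
  have h := congrFun ha g
  simp only [Fintype.sum_prod_type, Finset.sum_apply, Pi.smul_apply, Pi.sub_apply, smul_eq_mul,
    mul_one, Pi.zero_apply] at h
  simpa only [Fin.sum_univ_castSucc, hrow, hcol, hA, zero_mul, add_zero, Finset.sum_const_zero]
    using h

/-- For a 2-transitive subgroup `G ≤ Sym(n)`, the `(n−1)²` vectors
`v_{i,j} − (1/n)·1` with `i,j ∈ [n−1]` are linearly independent and form a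
basis of the standard module of `G`, i.e. of the column space of the projection
matrix `E` with entries `E_{π,σ} = ((n−1)/|G|)·(fix(π⁻¹σ) − 1)`. -/
theorem basis_of_standard_module {n : ℕ} (hn : 2 ≤ n)
    (G : Subgroup (Equiv.Perm (Fin n))) [Fintype G]
    (h2t : ∀ a b c d : Fin n, a ≠ b → c ≠ d →
      ∃ g : G, (g : Equiv.Perm (Fin n)) a = c ∧ (g : Equiv.Perm (Fin n)) b = d) :
    let E : Matrix G G ℝ := fun π σ =>
      (((n : ℝ) - 1) / (Fintype.card G : ℝ)) *
        (((Finset.univ.filter fun x : Fin n =>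
            ((π⁻¹ * σ : G) : Equiv.Perm (Fin n)) x = x).card : ℝ) - 1)
    let v : Fin n → Fin n → (G → ℝ) :=
      fun i j => fun g => if (g : Equiv.Perm (Fin n)) i = j then 1 else 0
    let one : G → ℝ := fun _ => 1
    let w : Fin (n - 1) × Fin (n - 1) → (G → ℝ) :=
      fun p => v (Fin.castLE (Nat.sub_le n 1) p.1) (Fin.castLE (Nat.sub_le n 1) p.2)
        - (1 / (n : ℝ)) • one
    LinearIndependent ℝ w ∧
      Submodule.span ℝ (Set.range w) = LinearMap.range E.mulVecLin := by
  obtain ⟨m, rfl⟩ : ∃ m, n = m + 1 := ⟨n - 1, by omega⟩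
  intro E v one w
  refine ⟨linearIndependent_castSucc_canonicalVector_sub hn G h2t,
    (span_castSucc_canonicalVector_sub G).trans ?_⟩
  classical
  have hn' : (2 : ℝ) ≤ ((m + 1 : ℕ) : ℝ) := by exact_mod_cast hn
  have hG : (Fintype.card G : ℝ) ≠ 0 := by exact_mod_cast Fintype.card_ne_zero
  let U : Matrix G (Fin (m + 1) × Fin (m + 1)) ℝ :=
    Matrix.of fun g p => canonicalVector G p.1 p.2 g - 1 / ((m + 1 : ℕ) : ℝ)
  have hE : E = ((((m + 1 : ℕ) : ℝ) - 1) / (Fintype.card G : ℝ)) • (U * Uᵀ) := by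
    ext π σ
    simp only [E, U, Matrix.smul_apply, Matrix.mul_apply, Matrix.transpose_apply,
      Matrix.of_apply, smul_eq_mul,
      Fintype.sum_prod_type, sum_canonicalVector_sub_mul (Nat.succ_ne_zero m),
      card_filter_inv_mul_fixed]
  have hsmul (c : ℝ) (M : Matrix G G ℝ) : (c • M).mulVecLin = c • M.mulVecLin :=
    LinearMap.ext fun x => Matrix.smul_mulVec c M x
  rw [hE, hsmul, LinearMap.range_smul _ _ (div_ne_zero (by linarith) hG),
    Matrix.range_mulVecLin_self_mul_transpose, Matrix.range_mulVecLin]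
  congr 2
  ext p g
  simp [U, Matrix.col]
end

section
/- (Module method.) Let n ≥ 3 and let G be a 2-transitive subgroup of Sym(n). Assume: (a) every intersecting subset of G has size at most |G|/n; (b) for every intersecting subset S ⊆ G with |S| = |G|/n, the characteristic vector v_S lies in the span over ℝ of {v_{i,j} : i,j ∈ [n]} (the direct sum of the trivial and standard modules of G); and (c) the vectors obtained by restricting v_{i,j}, for i,j ∈ [n−1] with i ≠ j, to the coordinates indexed by the derangements D_G are linearly independent (i.e., the matrix M for G has full rank (n−1)(n−2)). Then G has the strict EKR property: every intersecting subset S ⊆ G with |S| = |G|/n equals S_{i,j} for some i,j ∈ [n]. -/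
/-- In a square array of vectors with all row and column sums equal to `c`, a submodule that
contains the upper left block and the lower right entry contains every entry. -/
theorem mem_of_row_col_sums {V : Type*} [AddCommGroup V] [Module ℝ V] {m : ℕ} (hm : 2 ≤ m)
    (v : Fin (m + 1) → Fin (m + 1) → V) (c : V)
    (hrow : ∀ i, ∑ j, v i j = c) (hcol : ∀ j, ∑ i, v i j = c) (W : Submodule ℝ V)
    (hblock : ∀ i j : Fin m, v i.castSucc j.castSucc ∈ W)
    (hlast : v (Fin.last m) (Fin.last m) ∈ W) (i j : Fin (m + 1)) : v i j ∈ W := by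
  simp only [Fin.sum_univ_castSucc] at hrow hcol
  have hsum : ((m : ℝ) - 1) • c =
      (∑ i : Fin m, ∑ j : Fin m, v i.castSucc j.castSucc) - v (Fin.last m) (Fin.last m) := by
    have h1 : ∑ i : Fin m, (∑ j : Fin m, v i.castSucc j.castSucc + v i.castSucc (Fin.last m))
        = (m : ℝ) • c := by
      rw [Finset.sum_congr rfl fun i _ => hrow i.castSucc]
      simp [Nat.cast_smul_eq_nsmul]
    rw [Finset.sum_add_distrib] at h1
    rw [sub_smul, one_smul, ← h1, ← hcol (Fin.last m)]
    abel
  have hm' : (m : ℝ) - 1 ≠ 0 := by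
    have : (2 : ℝ) ≤ m := by exact_mod_cast hm
    linarith
  have hc : c ∈ W := by
    rw [← W.smul_mem_iff hm', hsum]
    exact W.sub_mem (W.sum_mem fun i _ => W.sum_mem fun j _ => hblock i j) hlast
  induction i using Fin.lastCases with
  | last =>
    induction j using Fin.lastCases with
    | last => exact hlast
    | cast j =>
      rw [eq_sub_iff_add_eq'.mpr (hcol j.castSucc)]
      exact W.sub_mem hc (W.sum_mem fun i _ => hblock i j)
  | cast i =>
    induction j using Fin.lastCases with
    | last =>
      rw [eq_sub_iff_add_eq'.mpr (hrow i.castSucc)]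
      exact W.sub_mem hc (W.sum_mem fun j _ => hblock i j)
    | cast j => exact hblock i j

/-- Jordan's theorem: a transitive action of a finite group on at least two points has an
element without fixed points. -/
theorem exists_forall_smul_ne {H X : Type*} [Group H] [Finite H] [MulAction H X] [Finite X]
    [Nontrivial X] [MulAction.IsPretransitive H X] : ∃ h : H, ∀ x : X, h • x ≠ x := by
  classical
  have := Fintype.ofFinite H
  have := Fintype.ofFinite X
  by_contra! hfix
  have : Fintype (Quotient (MulAction.orbitRel H X)) := Fintype.ofFinite _
  have hB := MulAction.sum_card_fixedBy_eq_card_orbits_mul_card_group H X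
  have horb : Fintype.card (Quotient (MulAction.orbitRel H X)) = 1 :=
    Fintype.card_eq_one_iff_nonempty_unique.mpr
      ((MulAction.pretransitive_iff_unique_quotient_of_nonempty H X).mp inferInstance)
  rw [horb, one_mul] at hB
  refine absurd hB (ne_of_gt ?_)
  rw [← Finset.card_univ, Finset.card_eq_sum_ones]
  refine Finset.sum_lt_sum (fun h _ => ?_) ⟨1, Finset.mem_univ _, ?_⟩
  · obtain ⟨x, hx⟩ := hfix h
    exact Fintype.card_pos_iff.mpr ⟨⟨x, hx⟩⟩
  · obtain ⟨x, y, hxy⟩ := exists_pair_ne X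
    exact Fintype.one_lt_card_iff.mpr
      ⟨⟨x, by simp⟩, ⟨y, by simp⟩, fun h => hxy (congrArg Subtype.val h)⟩

/-- In a 2-transitive group of degree at least three every point is the unique fixed point of
some element. -/
theorem exists_unique_fixed_point {n : ℕ} (hn : 3 ≤ n) (G : Subgroup (Equiv.Perm (Fin n)))
    (h2t : ∀ a b c d : Fin n, a ≠ b → c ≠ d →
      ∃ g : G, (g : Equiv.Perm (Fin n)) a = c ∧ (g : Equiv.Perm (Fin n)) b = d)
    (i : Fin n) : ∃ g : G, ∀ x, (g : Equiv.Perm (Fin n)) x = x ↔ x = i := by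
  let X := SubMulAction.ofStabilizer G i
  have hmem : ∀ x : Fin n, x ∈ X ↔ x ≠ i := fun x => SubMulAction.mem_ofStabilizer_iff G i
  have hX : Nontrivial X := by
    have : 1 < ({i}ᶜ : Finset (Fin n)).card := by
      rw [Finset.card_compl, Finset.card_singleton, Fintype.card_fin]
      omega
    obtain ⟨a, ha, b, hb, hab⟩ := Finset.one_lt_card.mp this
    exact ⟨⟨a, (hmem a).mpr (by simpa using ha)⟩, ⟨b, (hmem b).mpr (by simpa using hb)⟩,
      fun h => hab (congrArg Subtype.val h)⟩
  have hT : MulAction.IsPretransitive (MulAction.stabilizer G i) X := by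
    refine ⟨fun x y => ?_⟩
    obtain ⟨g, hgi, hgx⟩ := h2t i x i y ((hmem _).mp x.2).symm ((hmem _).mp y.2).symm
    exact ⟨⟨g, hgi⟩, Subtype.ext hgx⟩
  obtain ⟨h, hh⟩ := exists_forall_smul_ne (H := MulAction.stabilizer G i) (X := X)
  refine ⟨h, fun x => ⟨fun hx => ?_, ?_⟩⟩
  · by_contra hxi
    exact hh ⟨x, (hmem x).mpr hxi⟩ (Subtype.ext hx)
  · rintro rfl
    exact h.2

/-- If the fixed-point sums of a weight of total mass one form the characteristic vector of
`S`, then `S` is a point stabilizer. -/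
theorem exists_eq_fixing_of_weight {n : ℕ} (hn : 3 ≤ n) (G : Subgroup (Equiv.Perm (Fin n)))
    [Fintype G]
    (h2t : ∀ a b c d : Fin n, a ≠ b → c ≠ d →
      ∃ g : G, (g : Equiv.Perm (Fin n)) a = c ∧ (g : Equiv.Perm (Fin n)) b = d)
    (S : Finset G) [DecidablePred (· ∈ S)] (h1 : 1 ∈ S) (z : Fin n → ℝ)
    (hz : ∀ g : G, (if g ∈ S then (1 : ℝ) else 0) =
      ∑ i, z i * if (g : Equiv.Perm (Fin n)) i = i then 1 else 0) :
    ∃ i, S = Finset.univ.filter (fun g : G => (g : Equiv.Perm (Fin n)) i = i) := by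
  have hz01 : ∀ i, z i = 0 ∨ z i = 1 := fun i => by
    obtain ⟨g, hg⟩ := exists_unique_fixed_point hn G h2t i
    have h := hz g
    simp only [hg, mul_ite, mul_one, mul_zero, Finset.sum_ite_eq', Finset.mem_univ,
      if_true] at h
    rw [← h]
    split_ifs <;> simp
  have hsum : ∑ i, z i = 1 := by simpa [h1] using (hz 1).symm
  obtain ⟨i, hi⟩ : ∃ i, z i = 1 := by
    by_contra! hne
    simp [fun i => (hz01 i).resolve_right (hne i)] at hsum
  have hother : ∀ j, j ≠ i → z j = 0 := fun j hj => by
    have hnn : ∀ k, 0 ≤ z k := fun k => by rcases hz01 k with h | h <;> simp [h]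
    have h := Finset.sum_le_univ_sum_of_nonneg hnn (s := {i, j})
    rw [Finset.sum_pair hj.symm, hsum, hi] at h
    linarith [hnn j]
  refine ⟨i, Finset.ext fun g => ?_⟩
  have h := hz g
  rw [Finset.sum_eq_single i (fun j _ hj => by simp [hother j hj]) (by simp), hi, one_mul] at h
  rw [Finset.mem_filter_univ]
  split_ifs at h <;> simp_all

/-- A vector in the span of the canonical vectors that vanishes on the derangements is a
combination of the vectors `v_{i,i}`, when the matrix `M` has full rank. -/
theorem exists_weight_of_mem_span {m : ℕ} (hm : 2 ≤ m) (G : Subgroup (Equiv.Perm (Fin (m + 1))))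
    (hc : LinearIndependent ℝ
      (fun p : {p : Fin m × Fin m // p.1 ≠ p.2} =>
        fun d : {g : G // ∀ x, (g : Equiv.Perm (Fin (m + 1))) x ≠ x} =>
          if ((d : G) : Equiv.Perm (Fin (m + 1))) p.1.1.castSucc = p.1.2.castSucc
          then (1 : ℝ) else 0))
    (f : G → ℝ)
    (hf : f ∈ Submodule.span ℝ {x : G → ℝ | ∃ i j : Fin (m + 1),
      x = fun g : G => if (g : Equiv.Perm (Fin (m + 1))) i = j then (1 : ℝ) else 0})
    (hder : ∀ g : G, (∀ x, (g : Equiv.Perm (Fin (m + 1))) x ≠ x) → f g = 0) :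
    ∃ z : Fin (m + 1) → ℝ, ∀ g : G, f g =
      ∑ i, z i * if (g : Equiv.Perm (Fin (m + 1))) i = i then 1 else 0 := by
  let v : Fin (m + 1) → Fin (m + 1) → G → ℝ :=
    fun i j g => if (g : Equiv.Perm (Fin (m + 1))) i = j then 1 else 0
  let diag : Fin (m + 1) → G → ℝ := fun i => v i i
  let off : {p : Fin m × Fin m // p.1 ≠ p.2} → G → ℝ := fun p => v p.1.1.castSucc p.1.2.castSucc
  let W := Submodule.span ℝ (Set.range diag) ⊔ Submodule.span ℝ (Set.range off)
  have hdiag : ∀ i, v i i ∈ W := fun i =>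
    Submodule.mem_sup_left (Submodule.subset_span ⟨i, rfl⟩)
  have hW : ∀ i j, v i j ∈ W := by
    refine mem_of_row_col_sums hm v 1 (fun i => ?_) (fun j => ?_) W (fun i j => ?_) (hdiag _)
    · ext g
      simp [v]
    · ext g
      simp [v, ← Equiv.eq_symm_apply]
    · by_cases hij : i = j
      · exact hij ▸ hdiag _
      · exact Submodule.mem_sup_right (Submodule.subset_span ⟨⟨(i, j), hij⟩, rfl⟩)
  have hfW : f ∈ W := by
    refine Submodule.span_le.mpr ?_ hf
    rintro _ ⟨i, j, rfl⟩
    exact hW i j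
  obtain ⟨a, ha, b, hb, rfl⟩ := Submodule.mem_sup.mp hfW
  obtain ⟨z, rfl⟩ := (Submodule.mem_span_range_iff_exists_fun ℝ).mp ha
  obtain ⟨w, rfl⟩ := (Submodule.mem_span_range_iff_exists_fun ℝ).mp hb
  have hw : ∀ p, w p = 0 := by
    refine Fintype.linearIndependent_iff.mp hc w (funext fun d => ?_)
    have h := hder d d.2
    simpa [diag, off, v, d.2, Finset.sum_apply] using h
  exact ⟨z, fun g => by simp [hw, diag, v, Finset.sum_apply]⟩


/-- **The module method.**
Let `G ≤ Sym(n)` be 2-transitive with `n ≥ 3` and suppose: (a) every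
intersecting subset of `G` has size at most `|G|/n`; (b) the characteristic
vector of every maximum intersecting subset lies in the span of the canonical
vectors `v_{i,j}`; (c) the matrix `M` for `G` (the restriction of the columns
`v_{i,j}`, `i ≠ j ∈ [n−1]`, to the rows indexed by derangements) has full rank.
Then `G` has the strict EKR property: every intersecting subset of size `|G|/n`
is a coset `S_{i,j}`. -/
theorem module_method {n : ℕ} (hn : 3 ≤ n)
    (G : Subgroup (Equiv.Perm (Fin n))) [Fintype G] [DecidableEq G]
    (h2t : ∀ a b c d : Fin n, a ≠ b → c ≠ d →
      ∃ g : G, (g : Equiv.Perm (Fin n)) a = c ∧ (g : Equiv.Perm (Fin n)) b = d)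
    (ha : ∀ S : Finset G,
      (∀ π ∈ S, ∀ σ ∈ S, ∃ x : Fin n, ((π * σ⁻¹ : G) : Equiv.Perm (Fin n)) x = x) →
      (S.card : ℝ) ≤ (Fintype.card G : ℝ) / n)
    (hb : ∀ S : Finset G,
      (∀ π ∈ S, ∀ σ ∈ S, ∃ x : Fin n, ((π * σ⁻¹ : G) : Equiv.Perm (Fin n)) x = x) →
      (S.card : ℝ) = (Fintype.card G : ℝ) / n →
      (fun g : G => if g ∈ S then (1 : ℝ) else 0) ∈
        Submodule.span ℝ {x : G → ℝ | ∃ i j : Fin n,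
          x = fun g : G => if (g : Equiv.Perm (Fin n)) i = j then (1 : ℝ) else 0})
    (hc : LinearIndependent ℝ
      (fun p : {p : Fin (n - 1) × Fin (n - 1) // p.1 ≠ p.2} =>
        fun d : {g : G // ∀ x : Fin n, ((g : G) : Equiv.Perm (Fin n)) x ≠ x} =>
          if ((d : G) : Equiv.Perm (Fin n)) (Fin.castLE (Nat.sub_le n 1) (p : Fin (n-1) × Fin (n-1)).1)
              = Fin.castLE (Nat.sub_le n 1) (p : Fin (n-1) × Fin (n-1)).2
          then (1 : ℝ) else 0)) :
    ∀ S : Finset G,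
      (∀ π ∈ S, ∀ σ ∈ S, ∃ x : Fin n, ((π * σ⁻¹ : G) : Equiv.Perm (Fin n)) x = x) →
      (S.card : ℝ) = (Fintype.card G : ℝ) / n →
      ∃ i j : Fin n, S = Finset.univ.filter
        (fun g : G => (g : Equiv.Perm (Fin n)) i = j) := by
  intro S hS hcard
  obtain ⟨m, rfl⟩ : ∃ m, n = m + 1 := ⟨n - 1, by omega⟩
  have hpos : (0 : ℝ) < S.card := by
    rw [hcard]
    have : 0 < Fintype.card G := Fintype.card_pos
    positivity
  obtain ⟨σ, hσ⟩ := Finset.card_pos.mp (by exact_mod_cast hpos)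
  let T : Finset G := S.map (mulRightEmbedding σ⁻¹)
  have hmemT : ∀ g, g ∈ T ↔ g * σ ∈ S := fun g => by
    simp only [T, Finset.mem_map, mulRightEmbedding_apply, mul_inv_eq_iff_eq_mul]
    exact ⟨by rintro ⟨a, ha, rfl⟩; exact ha, fun h => ⟨_, h, rfl⟩⟩
  have hT : ∀ π ∈ T, ∀ τ ∈ T, ∃ x, ((π * τ⁻¹ : G) : Equiv.Perm (Fin (m + 1))) x = x := by
    intro π hπ τ hτ
    have h := hS _ ((hmemT π).mp hπ) _ ((hmemT τ).mp hτ)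
    rwa [show π * σ * (τ * σ)⁻¹ = π * τ⁻¹ by group] at h
  have hT1 : (1 : G) ∈ T := (hmemT 1).mpr (by rwa [one_mul])
  obtain ⟨z, hz⟩ := exists_weight_of_mem_span (by omega) G hc _
    (hb T hT (by rwa [Finset.card_map])) fun g hg => if_neg fun hgT => by
      obtain ⟨x, hx⟩ := hT g hgT 1 hT1
      rw [inv_one, mul_one] at hx
      exact hg x hx
  obtain ⟨i, hi⟩ := exists_eq_fixing_of_weight hn G h2t T hT1 z hz
  refine ⟨(σ : Equiv.Perm (Fin (m + 1))).symm i, i, Finset.ext fun g => ?_⟩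
  have h := hmemT (g * σ⁻¹)
  rw [inv_mul_cancel_right, hi, Finset.mem_filter_univ] at h
  rw [Finset.mem_filter_univ, ← h]
  rfl
end

section
/- For every n > 3, every eigenvalue of the adjacency matrix of the pairs graph X_n is at least −(n−3). -/
open Matrix

open Finset in
/-- The spectral gap estimate for symmetric matrices with zero diagonal. -/
lemma two_mul_sum_sq_rowSum_le_of_symm {ι : Type*} [Fintype ι]
    (hc : 3 ≤ Fintype.card ι) (s : ι → ι → ℝ) (hs : ∀ i j, s i j = s j i) (h0 : ∀ i, s i i = 0) :
    2 * ∑ i, (∑ j, s i j) ^ 2 ≤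
      (∑ i, ∑ j, s i j) ^ 2 + ((Fintype.card ι : ℝ) - 2) * ∑ i, ∑ j, s i j ^ 2 := by
  have hm : (3 : ℝ) ≤ Fintype.card ι := by exact_mod_cast hc
  set m : ℝ := (Fintype.card ι : ℝ) with hmdef
  set r : ι → ℝ := fun i => ∑ j, s i j with hr
  set S : ℝ := ∑ i, r i with hS
  set R : ℝ := ∑ i, r i ^ 2 with hR
  set Q : ℝ := ∑ i, ∑ j, s i j ^ 2 with hQ
  change 2 * R ≤ S ^ 2 + (m - 2) * Q
  have hrc : ∀ j, ∑ i, s i j = r j := fun j => sum_congr rfl fun i _ => hs i j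
  set t : ℝ := S / m with ht
  have hS' : S = m * t := by rw [ht]; field_simp
  have hdiag : ∑ i, (t - 2 * r i) ^ 2 ≤ ∑ i, ∑ j, ((m - 2) * s i j - r i - r j + t) ^ 2 := by
    refine sum_le_sum fun i _ => ?_
    calc (t - 2 * r i) ^ 2 = ((m - 2) * s i i - r i - r i + t) ^ 2 := by rw [h0]; ring
      _ ≤ _ := single_le_sum (f := fun j => ((m - 2) * s i j - r i - r j + t) ^ 2)
        (fun j _ => sq_nonneg _) (mem_univ i)
  have h1 : ∑ i, (t - 2 * r i) ^ 2 = m * t ^ 2 - 4 * t * S + 4 * R := by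
    calc _ = ∑ i, (t ^ 2 - 4 * t * r i + 4 * r i ^ 2) := sum_congr rfl fun i _ => by ring
      _ = _ := by
        simp only [sum_add_distrib, sum_sub_distrib, ← mul_sum, sum_const, card_univ,
          nsmul_eq_mul, ← hmdef, ← hS, ← hR]
  have hsr : ∑ i, ∑ j, s i j * r j = R := by
    rw [sum_comm]
    simp only [← sum_mul, hrc, hR, sq]
  have h2 : ∑ i, ∑ j, ((m - 2) * s i j - r i - r j + t) ^ 2 =
      (m - 2) ^ 2 * Q + 2 * m * R + m ^ 2 * t ^ 2 - 4 * (m - 2) * R + 2 * (m - 2) * t * S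
        + 2 * S ^ 2 - 4 * m * t * S := by
    calc _ = ∑ i, ∑ j, ((m - 2) ^ 2 * s i j ^ 2 + r i ^ 2 + r j ^ 2 + t ^ 2
          - 2 * (m - 2) * (r i * s i j) - 2 * (m - 2) * (s i j * r j) + 2 * (m - 2) * t * s i j
          + 2 * (r i * r j) - 2 * t * r i - 2 * t * r j) :=
            sum_congr rfl fun i _ => sum_congr rfl fun j _ => by ring
      _ = _ := by
        simp only [sum_add_distrib, sum_sub_distrib, ← mul_sum, sum_const, card_univ,
          nsmul_eq_mul, ← hmdef, hsr, ← sum_mul]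
        change (m - 2) ^ 2 * Q + m * R + m * R + m * (m * t ^ 2)
          - 2 * (m - 2) * (∑ i, r i * r i) - 2 * (m - 2) * R + 2 * (m - 2) * t * S
          + 2 * (S * S) - 2 * t * (m * S) - 2 * t * (m * S) = _
        simp only [← sq, ← hR]
        ring
  rw [h1, h2, hS'] at hdiag
  rw [hS']
  have h3 : 0 ≤ (m - 2) * ((m * t) ^ 2 + (m - 2) * Q - 2 * R) := by
    have : 0 ≤ (m - 3) * (m * t) ^ 2 + m * t ^ 2 := by
      have : 0 ≤ m - 3 := by linarith
      positivity
    linarith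
  have := nonneg_of_mul_nonneg_right h3 (by linarith)
  linarith

open Finset in
/-- The spectral gap estimate for antisymmetric matrices. -/
lemma two_mul_sum_sq_rowSum_le_of_antisymm {ι : Type*} [Fintype ι] (a : ι → ι → ℝ)
    (ha : ∀ i j, a i j = -a j i) :
    2 * ∑ i, (∑ j, a i j) ^ 2 ≤ (Fintype.card ι : ℝ) * ∑ i, ∑ j, a i j ^ 2 := by
  rcases isEmpty_or_nonempty ι with hι | hι
  · simp
  have hm : (0 : ℝ) < Fintype.card ι := by exact_mod_cast Fintype.card_pos
  set m : ℝ := (Fintype.card ι : ℝ) with hmdef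
  set r : ι → ℝ := fun i => ∑ j, a i j with hr
  set R : ℝ := ∑ i, r i ^ 2 with hR
  set Q : ℝ := ∑ i, ∑ j, a i j ^ 2 with hQ
  change 2 * R ≤ m * Q
  have hrc : ∀ j, ∑ i, a i j = -r j := fun j => by
    rw [hr, ← sum_neg_distrib]
    exact sum_congr rfl fun i _ => ha i j
  have hS : ∑ i, r i = 0 := by
    have : ∑ i, r i = -∑ i, r i := by
      rw [← sum_neg_distrib]
      simp only [← hrc]
      exact sum_comm
    linarith
  have har : ∑ i, ∑ j, a i j * r j = -R := by
    rw [sum_comm]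
    simp only [← sum_mul, hrc, hR, sq, neg_mul, sum_neg_distrib]
  have h2 : ∑ i, ∑ j, (m * a i j - r i + r j) ^ 2 = m * (m * Q - 2 * R) := by
    calc _ = ∑ i, ∑ j, (m ^ 2 * a i j ^ 2 + r i ^ 2 + r j ^ 2
          - 2 * m * (r i * a i j) + 2 * m * (a i j * r j) - 2 * (r i * r j)) :=
            sum_congr rfl fun i _ => sum_congr rfl fun j _ => by ring
      _ = _ := by
        simp only [sum_add_distrib, sum_sub_distrib, ← mul_sum, sum_const, card_univ,
          nsmul_eq_mul, ← hmdef, har, hS]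
        change m ^ 2 * Q + m * R + m * R - 2 * m * (∑ i, r i * r i) + 2 * m * (-R)
          - 2 * (∑ i, r i * 0) = _
        simp only [← sq, ← hR, mul_zero, sum_const_zero]
        ring
  have h3 : 0 ≤ m * (m * Q - 2 * R) :=
    h2 ▸ sum_nonneg fun i _ => sum_nonneg fun j _ => sq_nonneg _
  have := nonneg_of_mul_nonneg_right h3 hm
  linarith

open Finset in
/-- The quadratic form of the pairs graph, shifted by `card ι - 2`, is nonnegative. -/
lemma sum_sq_rowSum_add_sum_sq_colSum_le {ι : Type*} [Fintype ι]
    (hc : 3 ≤ Fintype.card ι) (f : ι → ι → ℝ) (h0 : ∀ i, f i i = 0) :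
    ∑ i, (∑ j, f i j) ^ 2 + ∑ j, (∑ i, f i j) ^ 2 + ∑ i, ∑ j, f i j * f j i ≤
      (∑ i, ∑ j, f i j) ^ 2 + ((Fintype.card ι : ℝ) - 1) * ∑ i, ∑ j, f i j ^ 2 := by
  have hsym := two_mul_sum_sq_rowSum_le_of_symm hc (fun i j => f i j + f j i)
    (fun i j => add_comm _ _) (fun i => by simp [h0])
  have hanti := two_mul_sum_sq_rowSum_le_of_antisymm (fun i j => f i j - f j i)
    (fun i j => by ring)
  have hS : ∑ i, ∑ j, f j i = ∑ i, ∑ j, f i j := sum_comm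
  have hQ : ∑ i, ∑ j, f j i ^ 2 = ∑ i, ∑ j, f i j ^ 2 := sum_comm
  simp only [add_sq, sub_sq, sum_add_distrib, sum_sub_distrib, mul_assoc, ← mul_sum, hS, hQ]
    at hsym hanti
  linarith

open Finset in
/-- Eigenvalue equation of the pairs graph, written for matrices with zero diagonal. -/
lemma neg_card_sub_two_le_of_eigen {ι : Type*} [Fintype ι]
    (hc : 3 ≤ Fintype.card ι) (f : ι → ι → ℝ) (h0 : ∀ i, f i i = 0) (μ : ℝ)
    (hf : ∃ i j, f i j ≠ 0)
    (h : ∀ i j, i ≠ j →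
      μ * f i j = (∑ k, ∑ l, f k l) - ∑ l, f i l - ∑ k, f k j + f i j - f j i) :
    -((Fintype.card ι : ℝ) - 2) ≤ μ := by
  have hpos : 0 < ∑ i, ∑ j, f i j ^ 2 := by
    obtain ⟨i, j, hij⟩ := hf
    refine sum_pos' (fun i _ => sum_nonneg fun j _ => sq_nonneg _) ⟨i, mem_univ i, ?_⟩
    exact sum_pos' (fun j _ => sq_nonneg _) ⟨j, mem_univ j, by positivity⟩
  have hquad : μ * ∑ i, ∑ j, f i j ^ 2 = (∑ i, ∑ j, f i j) ^ 2 - ∑ i, (∑ j, f i j) ^ 2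
      - ∑ j, (∑ i, f i j) ^ 2 + ∑ i, ∑ j, f i j ^ 2 - ∑ i, ∑ j, f i j * f j i := by
    calc _ = ∑ i, ∑ j, ((∑ k, ∑ l, f k l) * f i j - (∑ l, f i l) * f i j
          - (∑ k, f k j) * f i j + f i j ^ 2 - f i j * f j i) := by
          simp only [mul_sum _ _ μ]
          refine sum_congr rfl fun i _ => sum_congr rfl fun j _ => ?_
          rcases eq_or_ne i j with rfl | hij
          · simp [h0]
          · linear_combination f i j * h i j hij
      _ = _ := by
        simp only [sum_add_distrib, sum_sub_distrib, ← mul_sum]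
        rw [sum_comm (f := fun i j => (∑ k, f k j) * f i j)]
        simp only [← mul_sum, ← sq]
  have hle := sum_sq_rowSum_add_sum_sq_colSum_le hc f h0
  have : 0 ≤ (μ + (Fintype.card ι - 2)) * ∑ i, ∑ j, f i j ^ 2 := by linarith
  have := nonneg_of_mul_nonneg_left this hpos
  linarith

/-- Every eigenvalue of the adjacency matrix of the pairs graph `X_n` (`n > 3`)
is at least `−(n−3)`. The vertices of `X_n` are ordered pairs `(i,j)` of
distinct points of `[n−1]`, with `(i,j) ~ (k,ℓ)` iff `{i,j} ∩ {k,ℓ} = ∅`, or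
(`i = ℓ` and `j ≠ k`), or (`j = k` and `i ≠ ℓ`). -/
theorem pairs_graph_least_eigenvalue {n : ℕ} (hn : 3 < n) :
    let V := {p : Fin (n - 1) × Fin (n - 1) // p.1 ≠ p.2}
    let A : Matrix V V ℝ := fun p q =>
      if (p.1.1 ≠ q.1.1 ∧ p.1.1 ≠ q.1.2 ∧ p.1.2 ≠ q.1.1 ∧ p.1.2 ≠ q.1.2) ∨
          (p.1.1 = q.1.2 ∧ p.1.2 ≠ q.1.1) ∨
          (p.1.2 = q.1.1 ∧ p.1.1 ≠ q.1.2)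
      then 1 else 0
    ∀ μ : ℝ, (∃ v : V → ℝ, v ≠ 0 ∧ A.mulVec v = μ • v) → -((n : ℝ) - 3) ≤ μ := by
  classical
  intro V A μ ⟨v, hv, hAv⟩
  have hcard : Fintype.card (Fin (n - 1)) = n - 1 := Fintype.card_fin _
  let f : Fin (n - 1) → Fin (n - 1) → ℝ := fun i j => if h : i ≠ j then v ⟨(i, j), h⟩ else 0
  have h0 : ∀ i, f i i = 0 := fun i => by simp [f]
  have hfv : ∀ q : V, f q.1.1 q.1.2 = v q := fun q => dif_pos q.2
  have key := neg_card_sub_two_le_of_eigen (by rw [hcard]; omega) f h0 μ ?_ ?_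
  · rw [hcard, Nat.cast_sub (by omega)] at key
    push_cast at key
    linarith
  · obtain ⟨q, hq⟩ := Function.ne_iff.mp hv
    exact ⟨q.1.1, q.1.2, by rw [hfv]; exact hq⟩
  · intro i j hij
    let g : Fin (n - 1) × Fin (n - 1) → ℝ := fun q =>
      f q.1 q.2 - (if q.1 = i then f q.1 q.2 else 0) - (if q.2 = j then f q.1 q.2 else 0)
        + (if q.1 = i then if q.2 = j then f q.1 q.2 else 0 else 0)
        - (if q.1 = j then if q.2 = i then f q.1 q.2 else 0 else 0)
    have hterm : ∀ q : V, A ⟨(i, j), hij⟩ q * v q = g q.1 := by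
      rintro ⟨⟨k, l⟩, hkl⟩
      rw [← hfv]
      simp only [A, g]
      have hkl' : k ≠ l := hkl
      grind
    have hsum : ∑ q : V, g q.1 = ∑ q, g q := by
      have hg : ∀ q, g q ≠ 0 → q.1 ≠ q.2 := by
        rintro ⟨k, l⟩ hq (rfl : k = l)
        simp [g, h0] at hq
      rw [← Finset.sum_filter_of_ne (p := fun q => q.1 ≠ q.2) fun q _ => hg q]
      exact (Finset.sum_subtype _ (by simp) g).symm
    have := congrFun hAv ⟨(i, j), hij⟩
    simp only [Matrix.mulVec, dotProduct, Pi.smul_apply, smul_eq_mul, hterm, hsum] at this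
    rw [← hfv] at this
    rw [← this, Fintype.sum_prod_type]
    simp only [g, Finset.sum_add_distrib, Finset.sum_sub_distrib]
    simp [Finset.sum_ite_irrel]
end

section
/- Let G be a subgroup of Sym(10) (permutations of a 10-element set) whose natural action is sharply 3-transitive, i.e., for any two triples of pairwise distinct points there is exactly one g ∈ G mapping the first triple to the second (equivalently, G is 3-transitive and |G| = 10·9·8 = 720). Then G has the strict EKR property: every intersecting subset S ⊆ G satisfies |S| ≤ 72, and every intersecting subset of size 72 equals S_{i,j} = {π ∈ G : π(i) = j} for some points i,j. (This covers the Mathieu group M_{10} and PGL(2,9).) -/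
namespace SharpEKR

open Finset

/-- The number of elements of `S` mapping `i` to `j`. -/
def pointCount (S : Finset (Equiv.Perm (Fin 10))) (i j : Fin 10) : ℚ :=
  ∑ π ∈ S, if π i = j then 1 else 0

/-- The number of elements of `S` mapping `a` to `c` and `b` to `d`. -/
def pairCount (S : Finset (Equiv.Perm (Fin 10))) (a b c d : Fin 10) : ℚ :=
  ∑ π ∈ S, (if π a = c then 1 else 0) * (if π b = d then 1 else 0)

/-- The deviation of `pairCount` from its orthogonal projection to the linear functions of
`pointCount`. -/
def residue (S : Finset (Equiv.Perm (Fin 10))) (a b c d : Fin 10) : ℚ :=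
  if c = d then 0 else
    pairCount S a b c d - ((9 * pointCount S a c + pointCount S b c) / 80 - (#S : ℚ) / 72) -
      (9 * pointCount S b d + pointCount S a d) / 80

/-- The number of points where `π` and `σ` agree. -/
def agreement (π σ : Equiv.Perm (Fin 10)) : ℚ :=
  ∑ a, if π a = σ a then 1 else 0

variable (S : Finset (Equiv.Perm (Fin 10)))

lemma sum_pointCount_right (i : Fin 10) : ∑ j, pointCount S i j = #S := by
  simp only [pointCount]
  rw [sum_comm]
  simp

lemma sum_pointCount_left (j : Fin 10) : ∑ i, pointCount S i j = #S := by
  simp only [pointCount]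
  rw [sum_comm]
  have h (π : Equiv.Perm (Fin 10)) : (∑ i, if π i = j then (1 : ℚ) else 0) = 1 := by
    rw [Equiv.sum_comp π (fun i => if i = j then (1 : ℚ) else 0)]
    simp
  simp [h]

lemma sum_pairCount_right (a b c : Fin 10) : ∑ d, pairCount S a b c d = pointCount S a c := by
  simp only [pairCount, pointCount]
  rw [sum_comm]
  refine sum_congr rfl fun π _ => ?_
  rw [← mul_sum]
  simp

lemma pairCount_swap (a b c d : Fin 10) : pairCount S a b c d = pairCount S b a d c := by
  simp only [pairCount, mul_comm]

lemma sum_pairCount_left (a b d : Fin 10) : ∑ c, pairCount S a b c d = pointCount S b d := by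
  simp only [pairCount_swap S a b, sum_pairCount_right]

lemma pairCount_self {a b : Fin 10} (hab : a ≠ b) (c : Fin 10) : pairCount S a b c c = 0 := by
  refine sum_eq_zero fun π _ => ?_
  by_cases h : π a = c
  · have : π b ≠ c := fun h' => hab (π.injective (h.trans h'.symm))
    simp [this]
  · simp [h]

lemma sum_ite_ne (c : Fin 10) (f : Fin 10 → ℚ) :
    (∑ d, if c = d then 0 else f d) = ∑ d, f d - f c := by
  rw [eq_sub_iff_add_eq, ← sum_erase_add _ _ (mem_univ c),
    ← sum_erase_add univ f (mem_univ c), if_pos rfl, add_zero]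
  congr 1
  exact sum_congr rfl fun d hd => if_neg (ne_of_mem_erase hd).symm

lemma sum_residue_right {a b : Fin 10} (hab : a ≠ b) (c : Fin 10) :
    ∑ d, residue S a b c d = 0 := by
  simp only [residue]
  rw [sum_ite_ne]
  simp only [sum_sub_distrib, ← sum_div, sum_add_distrib, ← mul_sum, sum_pairCount_right,
    sum_pointCount_right, pairCount_self S hab]
  simp
  ring

lemma residue_swap (a b c d : Fin 10) : residue S a b c d = residue S b a d c := by
  simp only [residue, eq_comm (a := c) (b := d), pairCount_swap S a b]
  split_ifs
  · rfl
  · ring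

lemma sum_residue_left {a b : Fin 10} (hab : a ≠ b) (d : Fin 10) :
    ∑ c, residue S a b c d = 0 := by
  simp only [residue_swap S a b, sum_residue_right S hab.symm]

lemma sum_residue_mul_fst {a b : Fin 10} (hab : a ≠ b) (f : Fin 10 → ℚ) :
    ∑ c, ∑ d, residue S a b c d * f c = 0 := by
  simp only [← sum_mul, sum_residue_right S hab, zero_mul, sum_const_zero]

lemma sum_residue_mul_snd {a b : Fin 10} (hab : a ≠ b) (f : Fin 10 → ℚ) :
    ∑ c, ∑ d, residue S a b c d * f d = 0 := by
  rw [sum_comm]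
  simp only [← sum_mul, sum_residue_left S hab, zero_mul, sum_const_zero]

lemma sum_pairCount_mul_fst (a b : Fin 10) (f : Fin 10 → ℚ) :
    ∑ c, ∑ d, pairCount S a b c d * f c = ∑ c, pointCount S a c * f c := by
  simp only [← sum_mul, sum_pairCount_right]

lemma sum_pairCount_mul_snd (a b : Fin 10) (f : Fin 10 → ℚ) :
    ∑ c, ∑ d, pairCount S a b c d * f d = ∑ d, pointCount S b d * f d := by
  rw [sum_comm]
  simp only [← sum_mul, sum_pairCount_left]

lemma sum_residue_sq {a b : Fin 10} (hab : a ≠ b) :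
    ∑ c, ∑ d, residue S a b c d ^ 2 =
      ∑ c, ∑ d, pairCount S a b c d ^ 2 -
        9 / 80 * (∑ c, pointCount S a c ^ 2 + ∑ c, pointCount S b c ^ 2) -
        1 / 40 * ∑ c, pointCount S a c * pointCount S b c + (#S : ℚ) ^ 2 / 72 := by
  set f : Fin 10 → ℚ := fun c => (9 * pointCount S a c + pointCount S b c) / 80 - (#S : ℚ) / 72
    with hf
  set g : Fin 10 → ℚ := fun d => (9 * pointCount S b d + pointCount S a d) / 80 with hg
  have key (c d : Fin 10) : residue S a b c d ^ 2 =
      pairCount S a b c d ^ 2 - pairCount S a b c d * f c - pairCount S a b c d * g d -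
        residue S a b c d * f c - residue S a b c d * g d := by
    by_cases h : c = d
    · subst h
      simp [residue, pairCount_self S hab]
    · simp only [residue, if_neg h, hf, hg]
      ring
  simp only [key, sum_sub_distrib, sum_residue_mul_fst S hab, sum_residue_mul_snd S hab,
    sum_pairCount_mul_fst, sum_pairCount_mul_snd, sub_zero]
  have h1 : ∑ c, pointCount S a c * f c = 9 / 80 * ∑ c, pointCount S a c ^ 2 +
      1 / 80 * ∑ c, pointCount S a c * pointCount S b c - (#S : ℚ) ^ 2 / 72 := by
    have : (#S : ℚ) ^ 2 / 72 = ∑ c, pointCount S a c * ((#S : ℚ) / 72) := by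
      rw [← sum_mul, sum_pointCount_right]
      ring
    rw [this, mul_sum, mul_sum, ← sum_add_distrib, ← sum_sub_distrib]
    refine sum_congr rfl fun c _ => ?_
    simp only [hf]
    ring
  have h2 : ∑ c, pointCount S b c * g c = 9 / 80 * ∑ c, pointCount S b c ^ 2 +
      1 / 80 * ∑ c, pointCount S a c * pointCount S b c := by
    rw [mul_sum, mul_sum, ← sum_add_distrib]
    refine sum_congr rfl fun c _ => ?_
    simp only [hg]
    ring
  rw [h1, h2]
  ring

lemma sum_pointCount_sq :
    ∑ a, ∑ c, pointCount S a c ^ 2 = ∑ π ∈ S, ∑ σ ∈ S, agreement π σ := by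
  have h (a : Fin 10) : ∑ c, pointCount S a c ^ 2 =
      ∑ π ∈ S, ∑ σ ∈ S, if π a = σ a then 1 else 0 := by
    simp only [pointCount, sq, sum_mul_sum]
    rw [sum_comm]
    refine sum_congr rfl fun π _ => ?_
    rw [sum_comm]
    refine sum_congr rfl fun σ _ => ?_
    simp [eq_comm]
  simp only [h, agreement]
  rw [sum_comm]
  refine sum_congr rfl fun π _ => ?_
  rw [sum_comm]

lemma sum_comm_pair {S : Finset (Equiv.Perm (Fin 10))}
    (f : Fin 10 → Equiv.Perm (Fin 10) → Equiv.Perm (Fin 10) → ℚ) :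
    ∑ c, ∑ π ∈ S, ∑ σ ∈ S, f c π σ = ∑ π ∈ S, ∑ σ ∈ S, ∑ c, f c π σ :=
  sum_comm.trans (sum_congr rfl fun _ _ => sum_comm)

lemma sum_pairCount_sq (a b : Fin 10) :
    ∑ c, ∑ d, pairCount S a b c d ^ 2 =
      ∑ π ∈ S, ∑ σ ∈ S, (if π a = σ a then 1 else 0) * (if π b = σ b then 1 else 0) := by
  have h (π σ : Equiv.Perm (Fin 10)) : ((if π a = σ a then 1 else 0) *
      (if π b = σ b then 1 else 0) : ℚ) = ∑ c, ∑ d,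
      ((if π a = c then 1 else 0) * (if π b = d then 1 else 0)) *
      ((if σ a = c then 1 else 0) * (if σ b = d then 1 else 0)) := by
    rw [Fintype.sum_eq_single (π a) (fun c hc => by simp [hc.symm]),
      Fintype.sum_eq_single (π b) (fun d hd => by simp [hd.symm])]
    simp [eq_comm]
  simp only [h, pairCount, sq, sum_mul_sum]
  rw [← sum_comm_pair]
  exact sum_congr rfl fun c _ => sum_comm_pair _

lemma sum_offDiag_pairCount_sq :
    (∑ a, ∑ b, if a = b then 0 else ∑ c, ∑ d, pairCount S a b c d ^ 2) =
      ∑ π ∈ S, ∑ σ ∈ S, (agreement π σ ^ 2 - agreement π σ) := by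
  have h (π σ : Equiv.Perm (Fin 10)) : agreement π σ ^ 2 - agreement π σ = ∑ a, ∑ b,
      if a = b then 0 else
        ((if π a = σ a then 1 else 0) * (if π b = σ b then 1 else 0) : ℚ) := by
    simp only [sum_ite_ne, sum_sub_distrib, agreement, sq, sum_mul_sum]
    congr 1
    exact sum_congr rfl fun a _ => by split_ifs <;> simp
  have hite (a b : Fin 10) (f : Equiv.Perm (Fin 10) → Equiv.Perm (Fin 10) → ℚ) :
      (if a = b then 0 else ∑ π ∈ S, ∑ σ ∈ S, f π σ) =
        ∑ π ∈ S, ∑ σ ∈ S, if a = b then 0 else f π σ := by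
    split_ifs <;> simp
  simp only [h, sum_pairCount_sq, hite]
  rw [← sum_comm_pair]
  exact sum_congr rfl fun a _ => sum_comm_pair _

lemma sum_offDiag_residue_sq :
    (∑ a, ∑ b, if a = b then 0 else ∑ c, ∑ d, residue S a b c d ^ 2) =
      ∑ π ∈ S, ∑ σ ∈ S, (agreement π σ ^ 2 - 3 * agreement π σ + 1) := by
  have h (a b : Fin 10) : (if a = b then 0 else ∑ c, ∑ d, residue S a b c d ^ 2) =
      (if a = b then 0 else ∑ c, ∑ d, pairCount S a b c d ^ 2) -
      (if a = b then 0 else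
        9 / 80 * (∑ c, pointCount S a c ^ 2 + ∑ c, pointCount S b c ^ 2) +
        1 / 40 * ∑ c, pointCount S a c * pointCount S b c - (#S : ℚ) ^ 2 / 72) := by
    split_ifs with hab
    · simp
    · rw [sum_residue_sq S hab]
      ring
  have hQ : ∑ a, ∑ b, ∑ c, pointCount S a c * pointCount S b c = 10 * (#S : ℚ) ^ 2 := by
    have (a : Fin 10) : ∑ b, ∑ c, pointCount S a c * pointCount S b c = (#S : ℚ) ^ 2 := by
      rw [sum_comm]
      simp only [← mul_sum, sum_pointCount_left]
      rw [← sum_mul, sum_pointCount_right, sq]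
    simp [this]
  have hR : ∑ a, ∑ c, pointCount S a c * pointCount S a c =
      ∑ π ∈ S, ∑ σ ∈ S, agreement π σ := by
    rw [← sum_pointCount_sq]
    simp only [sq]
  simp only [h, sum_sub_distrib, sum_offDiag_pairCount_sq]
  simp only [sum_ite_ne, sum_sub_distrib, sum_add_distrib, ← mul_sum, hQ, sum_pointCount_sq, hR,
    sum_const, card_univ, Fintype.card_fin, nsmul_eq_mul]
  push_cast
  ring

/-- Distinct members of `S` agree in one or two points. -/
def MeetsLightly : Prop :=
  ∀ π ∈ S, ∀ σ ∈ S, π ≠ σ → agreement π σ = 1 ∨ agreement π σ = 2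

variable {S}

lemma MeetsLightly.sum_residue_sq (hS : MeetsLightly S) :
    (∑ a, ∑ b, if a = b then 0 else ∑ c, ∑ d, residue S a b c d ^ 2) =
      (#S : ℚ) * (72 - #S) := by
  have h : ∀ π ∈ S, ∀ σ ∈ S, agreement π σ ^ 2 - 3 * agreement π σ + 1 =
      (if π = σ then 72 else 0) - 1 := by
    intro π hπ σ hσ
    by_cases hne : π = σ
    · subst hne
      norm_num [agreement]
    · rcases hS π hπ σ hσ hne with h | h <;> rw [h, if_neg hne] <;> norm_num
  rw [sum_offDiag_residue_sq, sum_congr rfl fun π hπ => sum_congr rfl (h π hπ)]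
  simp only [sum_sub_distrib, sum_ite_eq, sum_ite_mem, inter_self, sum_const, nsmul_eq_mul]
  ring

lemma MeetsLightly.card_le (hS : MeetsLightly S) : #S ≤ 72 := by
  by_contra! h
  have h' : (72 : ℚ) < #S := by exact_mod_cast h
  have h0 : (0 : ℚ) ≤ ∑ a, ∑ b, if a = b then 0 else ∑ c, ∑ d, residue S a b c d ^ 2 :=
    sum_nonneg fun a _ => sum_nonneg fun b _ => by split_ifs <;> positivity
  rw [hS.sum_residue_sq] at h0
  nlinarith

lemma MeetsLightly.residue_eq_zero (hS : MeetsLightly S) (hcard : #S = 72) {a b : Fin 10}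
    (hab : a ≠ b) (c d : Fin 10) : residue S a b c d = 0 := by
  have h := hS.sum_residue_sq
  rw [hcard] at h
  norm_num at h
  have hnn (a b : Fin 10) :
      (0 : ℚ) ≤ if a = b then 0 else ∑ c, ∑ d, residue S a b c d ^ 2 := by
    split_ifs <;> positivity
  have h1 := (sum_eq_zero_iff_of_nonneg fun a _ => sum_nonneg fun b _ => hnn a b).1 h a (mem_univ a)
  have h2 := (sum_eq_zero_iff_of_nonneg fun b _ => hnn a b).1 h1 b (mem_univ b)
  rw [if_neg hab] at h2
  have h3 := (sum_eq_zero_iff_of_nonneg fun c _ => by positivity).1 h2 c (mem_univ c)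
  have h4 := (sum_eq_zero_iff_of_nonneg fun d _ => by positivity).1 h3 d (mem_univ d)
  exact pow_eq_zero_iff two_ne_zero |>.1 h4

/-- Two nonnegative rows of length ten with sum `72` whose differences are congruent modulo `80` to
a common multiple of `8` either agree or one of them has an entry `72`. -/
lemma eq_or_exists_eq_of_sub_modEq {x y : Fin 10 → ℤ} (hx : ∀ c, 0 ≤ x c) (hy : ∀ c, 0 ≤ y c)
    (hsx : ∑ c, x c = 72) (hsy : ∑ c, y c = 72) {t : ℤ} (ht0 : 0 ≤ t) (ht : t < 10)
    (h : ∀ c, 80 ∣ x c - y c - 8 * t) :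
    x = y ∨ ∃ c, x c = 72 ∨ y c = 72 := by
  have hx' (c : Fin 10) : x c ≤ 72 := hsx ▸ single_le_sum (fun i _ => hx i) (mem_univ c)
  have hy' (c : Fin 10) : y c ≤ 72 := hsy ▸ single_le_sum (fun i _ => hy i) (mem_univ c)
  have hd (c : Fin 10) : x c - y c = 8 * t ∨ x c - y c = 8 * t - 80 := by
    have := h c; have := hx c; have := hy c; have := hx' c; have := hy' c
    omega
  let k : Fin 10 → ℤ := fun c => if x c - y c = 8 * t then 0 else 1
  have hk (c : Fin 10) : x c - y c = 8 * t - 80 * k c := by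
    simp only [k]
    have := hd c
    split_ifs <;> omega
  have hk01 (c : Fin 10) : k c = 0 ∨ k c = 1 := by
    simp only [k]
    split_ifs <;> simp
  have hsum : ∑ c, k c = t := by
    have h1 : ∑ c, (x c - y c) = ∑ c, (8 * t - 80 * k c) := sum_congr rfl fun c _ => hk c
    rw [sum_sub_distrib, sum_sub_distrib, hsx, hsy] at h1
    simp only [← mul_sum, sum_const, card_univ, Fintype.card_fin, nsmul_eq_mul] at h1
    push_cast at h1
    omega
  have hle : t * (80 - 8 * t) ≤ 72 := by
    nth_rewrite 1 [← hsum]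
    rw [← hsy, sum_mul]
    refine sum_le_sum fun c _ => ?_
    have := hk c; have := hx c; have := hy c
    rcases hk01 c with h0 | h1
    · rw [h0]; omega
    · rw [h1, one_mul]; omega
  have hcases : t = 0 ∨ t = 1 ∨ t = 9 := by
    interval_cases t <;> simp at hle ⊢
  rcases hcases with rfl | rfl | rfl
  · left
    have h0 := (sum_eq_zero_iff_of_nonneg fun c _ => by rcases hk01 c with h | h <;> omega).1 hsum
    funext c
    have := hk c
    have := h0 c (mem_univ c)
    omega
  · right
    obtain ⟨c, -, hc⟩ : ∃ c ∈ univ, k c ≠ 0 := exists_ne_zero_of_sum_ne_zero (by rw [hsum]; simp)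
    refine ⟨c, Or.inr ?_⟩
    have := hk c; have := hk01 c; have := hx c; have := hy' c
    omega
  · right
    obtain ⟨c, hc⟩ : ∃ c, k c = 0 := by
      by_contra! hne
      have : ∑ c, k c = ∑ _c : Fin 10, 1 :=
        sum_congr rfl fun c _ => (hk01 c).resolve_left (hne c)
      rw [hsum] at this
      simp at this
    refine ⟨c, Or.inl ?_⟩
    have := hk c; have := hx' c; have := hy c
    omega

/-- A nonnegative integer matrix of order ten with row and column sums `72` whose `2 × 2` minors
satisfy the given congruence modulo `80` has an entry `72`. -/
lemma exists_entry_eq {m : Fin 10 → Fin 10 → ℤ} (hm : ∀ a c, 0 ≤ m a c)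
    (hrow : ∀ a, ∑ c, m a c = 72) (hcol : ∀ c, ∑ a, m a c = 72)
    (h : ∀ a b c d, a ≠ b → c ≠ d → 80 ∣ 9 * (m a c + m b d) + m a d + m b c) :
    ∃ a c, m a c = 72 := by
  by_contra! hne
  have hconst (a b : Fin 10) : m a = m b := by
    have hdiff (c d : Fin 10) (hcd : c ≠ d) : 80 ∣ (m a c - m b c) + 9 * (m a d - m b d) := by
      by_cases hab : a = b
      · simp [hab]
      obtain ⟨e, hea, heb⟩ : ∃ e : Fin 10, e ≠ a ∧ e ≠ b := by
        revert a b; decide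
      have h1 := h e a c d hea hcd
      have h2 := h e b c d heb hcd
      omega
    have h8 (c d : Fin 10) : 8 ∣ m a c - m b c ∧
        80 ∣ (m a c - m b c) - (m a d - m b d) := by
      obtain ⟨e, f, hec, hed, hfc, hfd, hef⟩ :
          ∃ e f : Fin 10, e ≠ c ∧ e ≠ d ∧ f ≠ c ∧ f ≠ d ∧ e ≠ f := by
        revert c d; decide
      have h1 := hdiff c e hec.symm
      have h2 := hdiff c f hfc.symm
      have h3 := hdiff e f hef
      have h4 := hdiff d e hed.symm
      omega
    have hr (c : Fin 10) : 80 ∣ m a c - m b c - 8 * ((m a 0 - m b 0) / 8 % 10) := by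
      have := h8 c 0
      have := h8 0 0
      omega
    rcases eq_or_exists_eq_of_sub_modEq (hm a) (hm b) (hrow a) (hrow b)
      (by omega) (by omega) hr with h | ⟨c, h | h⟩
    · exact h
    · exact absurd h (hne a c)
    · exact absurd h (hne b c)
  have h0 := hcol 0
  simp only [hconst _ 0, sum_const, card_univ, Fintype.card_fin, nsmul_eq_mul] at h0
  push_cast at h0
  omega

lemma pointCount_eq_card (i j : Fin 10) : pointCount S i j = #{π ∈ S | π i = j} := by
  simp [pointCount]

lemma pairCount_eq_card (a b c d : Fin 10) :
    pairCount S a b c d = #{π ∈ S | π a = c ∧ π b = d} := by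
  simp only [pairCount, ite_zero_mul_ite_zero, mul_one, sum_boole]

lemma MeetsLightly.exists_forall_apply_eq (hS : MeetsLightly S) (hcard : #S = 72) :
    ∃ i j, ∀ π ∈ S, π i = j := by
  obtain ⟨i, j, hij⟩ := exists_entry_eq (m := fun a c => (#{π ∈ S | π a = c} : ℤ))
    (fun _ _ => by positivity)
    (fun a => by
      have := sum_pointCount_right S a
      simp only [pointCount_eq_card, hcard] at this
      exact_mod_cast this)
    (fun c => by
      have := sum_pointCount_left S c
      simp only [pointCount_eq_card, hcard] at this
      exact_mod_cast this)
    (fun a b c d hab hcd => by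
      have := hS.residue_eq_zero hcard hab c d
      rw [residue, if_neg hcd, hcard] at this
      simp only [pointCount_eq_card, pairCount_eq_card] at this
      refine ⟨(#{π ∈ S | π a = c ∧ π b = d} : ℤ) + 1, ?_⟩
      have h' : (9 * (#{π ∈ S | π a = c} + #{π ∈ S | π b = d}) + #{π ∈ S | π a = d} +
          #{π ∈ S | π b = c} : ℚ) = 80 * (#{π ∈ S | π a = c ∧ π b = d} + 1) := by
        push_cast at this
        linarith
      exact_mod_cast h')
  refine ⟨i, j, ?_⟩
  have h72 : #{π ∈ S | π i = j} = #S := by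
    rw [hcard]
    exact_mod_cast hij
  exact card_filter_eq_iff.1 h72

lemma agreement_eq_card (π σ : Equiv.Perm (Fin 10)) :
    agreement π σ = #{a | π a = σ a} := by
  simp [agreement]

/-- In a permutation group whose elements are determined by their values at three points, an
intersecting set meets lightly. -/
lemma meetsLightly_map {G : Subgroup (Equiv.Perm (Fin 10))}
    (hG : ∀ π σ : G, ∀ a b c : Fin 10, a ≠ b → a ≠ c → b ≠ c →
      (π : Equiv.Perm (Fin 10)) a = σ.1 a → π.1 b = σ.1 b → π.1 c = σ.1 c → π = σ)
    {S : Finset G}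
    (hS : ∀ π ∈ S, ∀ σ ∈ S, ∃ x : Fin 10, ((π * σ⁻¹ : G) : Equiv.Perm (Fin 10)) x = x) :
    MeetsLightly (S.map (Function.Embedding.subtype _)) := by
  intro π hπ σ hσ hne
  rcases mem_map.1 hπ with ⟨π, hπS, rfl⟩
  rcases mem_map.1 hσ with ⟨σ, hσS, rfl⟩
  simp only [Function.Embedding.subtype_apply] at hne ⊢
  rw [agreement_eq_card]
  have hpos : 0 < #{a | π.1 a = σ.1 a} := by
    obtain ⟨x, hx⟩ := hS π hπS σ hσS
    refine card_pos.2 ⟨σ.1⁻¹ x, ?_⟩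
    simpa using hx
  have hle : #{a | π.1 a = σ.1 a} ≤ 2 := by
    by_contra! h
    obtain ⟨a, b, c, ha, hb, hc, hab, hac, hbc⟩ := two_lt_card_iff.1 h
    simp only [mem_filter, mem_univ, true_and] at ha hb hc
    exact hne (congrArg Subtype.val (hG π σ a b c hab hac hbc ha hb hc))
  have : #{a | π.1 a = σ.1 a} = 1 ∨ #{a | π.1 a = σ.1 a} = 2 := by omega
  exact_mod_cast this

end SharpEKR

/-- Every sharply 3-transitive subgroup of `Sym(10)` (in particular the Mathieu
group `M₁₀` and `PGL(2,9)`) has the strict EKR property: every intersecting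
subset has size at most `72 = 720/10`, and the intersecting subsets of size
`72` are exactly the cosets `S_{i,j} = {π ∈ G : π(i) = j}`. -/
theorem strict_ekr_sharply_three_transitive_degree_ten
    (G : Subgroup (Equiv.Perm (Fin 10))) [Fintype G]
    (hsharp : ∀ a₁ a₂ a₃ b₁ b₂ b₃ : Fin 10,
      a₁ ≠ a₂ → a₁ ≠ a₃ → a₂ ≠ a₃ → b₁ ≠ b₂ → b₁ ≠ b₃ → b₂ ≠ b₃ →
      ∃! g : G, (g : Equiv.Perm (Fin 10)) a₁ = b₁ ∧
        (g : Equiv.Perm (Fin 10)) a₂ = b₂ ∧ (g : Equiv.Perm (Fin 10)) a₃ = b₃) :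
    ∀ S : Finset G,
      (∀ π ∈ S, ∀ σ ∈ S, ∃ x : Fin 10, ((π * σ⁻¹ : G) : Equiv.Perm (Fin 10)) x = x) →
      S.card ≤ 72 ∧
      (S.card = 72 → ∃ i j : Fin 10, S = Finset.univ.filter
        (fun g : G => (g : Equiv.Perm (Fin 10)) i = j)) := by
  have hG : ∀ π σ : G, ∀ a b c : Fin 10, a ≠ b → a ≠ c → b ≠ c →
      (π : Equiv.Perm (Fin 10)) a = σ.1 a → π.1 b = σ.1 b → π.1 c = σ.1 c → π = σ :=
    fun π σ a b c hab hac hbc ha hb hc =>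
      (hsharp a b c (σ.1 a) (σ.1 b) (σ.1 c) hab hac hbc (σ.1.injective.ne hab)
        (σ.1.injective.ne hac) (σ.1.injective.ne hbc)).unique ⟨ha, hb, hc⟩ ⟨rfl, rfl, rfl⟩
  have hbound : ∀ S : Finset G,
      (∀ π ∈ S, ∀ σ ∈ S, ∃ x : Fin 10, ((π * σ⁻¹ : G) : Equiv.Perm (Fin 10)) x = x) →
      S.card ≤ 72 := fun S hS => by
    simpa using (SharpEKR.meetsLightly_map hG hS).card_le
  refine fun S hS => ⟨hbound S hS, fun hcard => ?_⟩
  obtain ⟨i, j, hij⟩ :=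
    (SharpEKR.meetsLightly_map hG hS).exists_forall_apply_eq (by simpa using hcard)
  refine ⟨i, j, Finset.eq_of_subset_of_card_le (fun π hπ => ?_) ?_⟩
  · exact Finset.mem_filter.2
      ⟨Finset.mem_univ _, hij π.1 (Finset.mem_map_of_mem (Function.Embedding.subtype _) hπ)⟩
  · rw [hcard]
    refine hbound _ fun π hπ σ hσ => ⟨j, ?_⟩
    have hπ := (Finset.mem_filter.1 hπ).2
    have hσ := (Finset.mem_filter.1 hσ).2
    have : (σ.1⁻¹ : Equiv.Perm (Fin 10)) j = i := by
      rw [Equiv.Perm.inv_eq_iff_eq]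
      exact hσ.symm
    change π.1 (σ.1⁻¹ j) = j
    rw [this, hπ]
end

section
/- Let G be a subgroup of Sym(11) (permutations of an 11-element set) whose natural action is sharply 4-transitive, i.e., for any two 4-tuples of pairwise distinct points there is exactly one g ∈ G mapping the first tuple to the second (equivalently, G is 4-transitive and |G| = 11·10·9·8 = 7920; such a G is the Mathieu group M_{11}). Then G has the strict EKR property: every intersecting subset S ⊆ G satisfies |S| ≤ 720, and every intersecting subset of size 720 equals S_{i,j} = {π ∈ G : π(i) = j} for some points i,j. -/
namespace SharplyFourTransitive

open Finset Equiv

/-- Sharp 4-transitivity of a permutation group of degree 11. -/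
def IsSharp (G : Subgroup (Perm (Fin 11))) : Prop :=
  ∀ a₁ a₂ a₃ a₄ b₁ b₂ b₃ b₄ : Fin 11,
    a₁ ≠ a₂ → a₁ ≠ a₃ → a₁ ≠ a₄ → a₂ ≠ a₃ → a₂ ≠ a₄ → a₃ ≠ a₄ →
    b₁ ≠ b₂ → b₁ ≠ b₃ → b₁ ≠ b₄ → b₂ ≠ b₃ → b₂ ≠ b₄ → b₃ ≠ b₄ →
    ∃! g : G, (g : Perm (Fin 11)) a₁ = b₁ ∧ (g : Perm (Fin 11)) a₂ = b₂ ∧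
      (g : Perm (Fin 11)) a₃ = b₃ ∧ (g : Perm (Fin 11)) a₄ = b₄

/-- The indicator of `g i = j`. -/
noncomputable def ind (g : Perm (Fin 11)) (i j : Fin 11) : ℝ := if g i = j then 1 else 0

/-- The number of points on which `x` and `y` agree. -/
noncomputable def agree (x y : Perm (Fin 11)) : ℝ := ∑ k, ind y k (x k)

/-- The indicator of `x` and `y` disagreeing everywhere. -/
noncomputable def apart (x y : Perm (Fin 11)) : ℝ := if ∀ k, y k ≠ x k then 1 else 0

lemma ind_mul_self (g : Perm (Fin 11)) (i j : Fin 11) : ind g i j * ind g i j = ind g i j := by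
  unfold ind; split_ifs <;> simp

lemma ind_nonneg (g : Perm (Fin 11)) (i j : Fin 11) : 0 ≤ ind g i j := by
  unfold ind; split_ifs <;> simp

lemma ind_mul_eq_zero_of_ne_left {g : Perm (Fin 11)} {i k j : Fin 11} (h : i ≠ k) :
    ind g i j * ind g k j = 0 := by
  unfold ind
  split_ifs with h₁ h₂ <;> simp
  exact h (g.injective (h₁.trans h₂.symm))

lemma ind_mul_eq_zero_of_ne_right {g : Perm (Fin 11)} {i j l : Fin 11} (h : j ≠ l) :
    ind g i j * ind g i l = 0 := by
  unfold ind
  split_ifs with h₁ h₂ <;> simp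
  exact h (h₁.symm.trans h₂)

lemma sum_ind_mul (g : Perm (Fin 11)) (i : Fin 11) (f : Fin 11 → ℝ) :
    ∑ j, f j * ind g i j = f (g i) := by
  simp [ind]

lemma sum_ind_right (g : Perm (Fin 11)) (i : Fin 11) : ∑ j, ind g i j = 1 := by
  simp [ind]

lemma sum_ind_left (g : Perm (Fin 11)) (j : Fin 11) : ∑ i, ind g i j = 1 := by
  have : ∀ i, ind g i j = if i = g⁻¹ j then 1 else 0 := fun i ↦ by
    simp [ind, Equiv.eq_symm_apply]
  simp [this]

lemma sum_eq_of_const_off {f : Fin 11 → ℝ} {c : ℝ} (t : Finset (Fin 11))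
    (h₀ : ∀ x ∈ t, f x = 0) (h : ∀ x, x ∉ t → f x = c) : ∑ x, f x = (11 - #t) * c := by
  rw [← Finset.sum_add_sum_compl t f, Finset.sum_eq_zero h₀,
    Finset.sum_congr rfl (fun x hx ↦ h x (Finset.mem_compl.1 hx)), Finset.sum_const,
    nsmul_eq_mul, Finset.card_compl, Nat.cast_sub (Finset.card_le_univ t)]
  simp

lemma exists_notMem (t : Finset (Fin 11)) (h : #t < 11) : ∃ x, x ∉ t := by
  by_contra! h'
  have : t = univ := Finset.eq_univ_iff_forall.2 h'
  simp [this] at h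

variable {G : Subgroup (Perm (Fin 11))}

lemma agree_self (x : Perm (Fin 11)) : agree x x = 11 := by
  simp [agree, ind]

lemma agree_eq_card (x y : Perm (Fin 11)) : agree x y = #{k | y k = x k} := by
  simp [agree, ind]

lemma card_eq_le_three (hG : IsSharp G) {x y : G} (h : x ≠ y) :
    #{k | (y : Perm (Fin 11)) k = (x : Perm (Fin 11)) k} ≤ 3 := by
  by_contra! hlt
  obtain ⟨t, ht, hc⟩ := Finset.exists_subset_card_eq (Nat.succ_le_of_lt hlt)
  obtain ⟨a, b, c, d, h₁₂, h₁₃, h₁₄, h₂₃, h₂₄, h₃₄, rfl⟩ := Finset.card_eq_four.1 hc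
  have e : ∀ k ∈ ({a, b, c, d} : Finset (Fin 11)),
      (y : Perm (Fin 11)) k = (x : Perm (Fin 11)) k := fun k hk ↦ by simpa using ht hk
  have inj := (x : Perm (Fin 11)).injective
  exact h ((hG a b c d _ _ _ _ h₁₂ h₁₃ h₁₄ h₂₃ h₂₄ h₃₄ (inj.ne h₁₂) (inj.ne h₁₃)
    (inj.ne h₁₄) (inj.ne h₂₃) (inj.ne h₂₄) (inj.ne h₃₄)).unique ⟨rfl, rfl, rfl, rfl⟩
    ⟨e a (by simp), e b (by simp), e c (by simp), e d (by simp)⟩)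

lemma agree_of_ne (hG : IsSharp G) {x y : G} (h : x ≠ y) :
    agree x y = 0 ∨ agree x y = 1 ∨ agree x y = 2 ∨ agree x y = 3 := by
  have := card_eq_le_three hG h
  rw [agree_eq_card]
  interval_cases #{k | (y : Perm (Fin 11)) k = (x : Perm (Fin 11)) k} <;> simp

lemma apart_eq (x y : Perm (Fin 11)) : apart x y = if agree x y = 0 then 1 else 0 := by
  rw [agree_eq_card, apart]
  simp [Finset.filter_eq_empty_iff]

lemma apart_comm (x y : Perm (Fin 11)) : apart x y = apart y x := by
  unfold apart
  simp only [ne_comm]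

/-- Inclusion-exclusion for the number of agreements. -/
lemma apart_eq_poly (hG : IsSharp G) (x y : G) :
    apart x y = 1 - agree x y + agree x y * (agree x y - 1) / 2
      - agree x y * (agree x y - 1) * (agree x y - 2) / 6 + if x = y then 120 else 0 := by
  rw [apart_eq]
  by_cases h : x = y
  · subst h; rw [agree_self]; norm_num
  · rcases agree_of_ne hG h with h' | h' | h' | h' <;> rw [h'] <;> norm_num [h]

variable [Fintype G]

lemma sum_eq_sum_sum_mul_ind (w : G → ℝ) (a : Fin 11) :
    ∑ g, w g = ∑ b, ∑ g : G, w g * ind g a b := by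
  rw [Finset.sum_comm]
  refine Finset.sum_congr rfl fun g _ ↦ ?_
  rw [← Finset.mul_sum, sum_ind_right, mul_one]

lemma sum_ind_four (hG : IsSharp G) {a₁ a₂ a₃ a₄ b₁ b₂ b₃ b₄ : Fin 11}
    (h₁₂ : a₁ ≠ a₂) (h₁₃ : a₁ ≠ a₃) (h₁₄ : a₁ ≠ a₄) (h₂₃ : a₂ ≠ a₃) (h₂₄ : a₂ ≠ a₄)
    (h₃₄ : a₃ ≠ a₄) (k₁₂ : b₁ ≠ b₂) (k₁₃ : b₁ ≠ b₃) (k₁₄ : b₁ ≠ b₄) (k₂₃ : b₂ ≠ b₃)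
    (k₂₄ : b₂ ≠ b₄) (k₃₄ : b₃ ≠ b₄) :
    ∑ g : G, ind g a₁ b₁ * ind g a₂ b₂ * ind g a₃ b₃ * ind g a₄ b₄ = 1 := by
  obtain ⟨g, ⟨e₁, e₂, e₃, e₄⟩, hu⟩ :=
    hG a₁ a₂ a₃ a₄ b₁ b₂ b₃ b₄ h₁₂ h₁₃ h₁₄ h₂₃ h₂₄ h₃₄ k₁₂ k₁₃ k₁₄ k₂₃ k₂₄ k₃₄
  rw [Finset.sum_eq_single g]
  · simp [ind, e₁, e₂, e₃, e₄]
  · intro x _ hx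
    by_contra hne
    apply hx
    apply hu
    simp only [ind] at hne
    refine ⟨?_, ?_, ?_, ?_⟩ <;> by_contra h <;> simp [h] at hne
  · simp

lemma sum_ind_three (hG : IsSharp G) {a₁ a₂ a₃ b₁ b₂ b₃ : Fin 11}
    (h₁₂ : a₁ ≠ a₂) (h₁₃ : a₁ ≠ a₃) (h₂₃ : a₂ ≠ a₃)
    (k₁₂ : b₁ ≠ b₂) (k₁₃ : b₁ ≠ b₃) (k₂₃ : b₂ ≠ b₃) :
    ∑ g : G, ind g a₁ b₁ * ind g a₂ b₂ * ind g a₃ b₃ = 8 := by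
  obtain ⟨a, ha⟩ := exists_notMem {a₁, a₂, a₃} (by
    have := Finset.card_le_three (a := a₁) (b := a₂) (c := a₃); omega)
  simp only [Finset.mem_insert, Finset.mem_singleton, not_or] at ha
  obtain ⟨n₁, n₂, n₃⟩ := ha
  rw [sum_eq_sum_sum_mul_ind _ a, sum_eq_of_const_off (c := 1) {b₁, b₂, b₃}]
  · rw [Finset.card_eq_three.2 ⟨b₁, b₂, b₃, k₁₂, k₁₃, k₂₃, rfl⟩]; norm_num
  · intro b hb
    refine Finset.sum_eq_zero fun g _ ↦ ?_
    simp only [Finset.mem_insert, Finset.mem_singleton] at hb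
    rcases hb with rfl | rfl | rfl
    · linear_combination ind g a₂ b₂ * ind g a₃ b₃ *
        ind_mul_eq_zero_of_ne_left (g := g) (j := b) (Ne.symm n₁)
    · linear_combination ind g a₁ b₁ * ind g a₃ b₃ *
        ind_mul_eq_zero_of_ne_left (g := g) (j := b) (Ne.symm n₂)
    · linear_combination ind g a₁ b₁ * ind g a₂ b₂ *
        ind_mul_eq_zero_of_ne_left (g := g) (j := b) (Ne.symm n₃)
  · intro b hb
    simp only [Finset.mem_insert, Finset.mem_singleton, not_or] at hb
    exact sum_ind_four hG h₁₂ h₁₃ (Ne.symm n₁) h₂₃ (Ne.symm n₂) (Ne.symm n₃)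
      k₁₂ k₁₃ (Ne.symm hb.1) k₂₃ (Ne.symm hb.2.1) (Ne.symm hb.2.2)

lemma sum_ind_two (hG : IsSharp G) {a₁ a₂ b₁ b₂ : Fin 11} (h : a₁ ≠ a₂) (k : b₁ ≠ b₂) :
    ∑ g : G, ind g a₁ b₁ * ind g a₂ b₂ = 72 := by
  obtain ⟨a, ha⟩ := exists_notMem {a₁, a₂} (by
    have := Finset.card_le_two (a := a₁) (b := a₂); omega)
  simp only [Finset.mem_insert, Finset.mem_singleton, not_or] at ha
  obtain ⟨n₁, n₂⟩ := ha
  rw [sum_eq_sum_sum_mul_ind _ a, sum_eq_of_const_off (c := 8) {b₁, b₂}]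
  · rw [Finset.card_pair k]; norm_num
  · intro b hb
    refine Finset.sum_eq_zero fun g _ ↦ ?_
    simp only [Finset.mem_insert, Finset.mem_singleton] at hb
    rcases hb with rfl | rfl
    · linear_combination ind g a₂ b₂ *
        ind_mul_eq_zero_of_ne_left (g := g) (j := b) (Ne.symm n₁)
    · linear_combination ind g a₁ b₁ *
        ind_mul_eq_zero_of_ne_left (g := g) (j := b) (Ne.symm n₂)
  · intro b hb
    simp only [Finset.mem_insert, Finset.mem_singleton, not_or] at hb
    exact sum_ind_three hG h (Ne.symm n₁) (Ne.symm n₂) k (Ne.symm hb.1) (Ne.symm hb.2)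

lemma sum_ind_one (hG : IsSharp G) (a b : Fin 11) : ∑ g : G, ind g a b = 720 := by
  obtain ⟨c, hc⟩ := exists_notMem {a} (by simp)
  rw [Finset.mem_singleton] at hc
  rw [sum_eq_sum_sum_mul_ind _ c, sum_eq_of_const_off (c := 72) {b}]
  · norm_num
  · intro x hx
    rw [Finset.mem_singleton] at hx
    subst hx
    exact Finset.sum_eq_zero fun g _ ↦ ind_mul_eq_zero_of_ne_left (Ne.symm hc)
  · intro x hx
    rw [Finset.mem_singleton] at hx
    exact sum_ind_two hG (Ne.symm hc) (Ne.symm hx)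

lemma card_eq (hG : IsSharp G) : (Fintype.card G : ℝ) = 7920 := by
  have h := sum_eq_sum_sum_mul_ind (fun _ : G ↦ (1 : ℝ)) 0
  simp only [one_mul, sum_ind_one hG] at h
  simp at h
  rw [h]; norm_num

lemma exists_map_three (hG : IsSharp G) {a₁ a₂ a₃ b₁ b₂ b₃ : Fin 11}
    (h₁₂ : a₁ ≠ a₂) (h₁₃ : a₁ ≠ a₃) (h₂₃ : a₂ ≠ a₃)
    (k₁₂ : b₁ ≠ b₂) (k₁₃ : b₁ ≠ b₃) (k₂₃ : b₂ ≠ b₃) :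
    ∃ g : G, (g : Perm (Fin 11)) a₁ = b₁ ∧ (g : Perm (Fin 11)) a₂ = b₂ ∧
      (g : Perm (Fin 11)) a₃ = b₃ := by
  by_contra! h
  have := sum_ind_three hG h₁₂ h₁₃ h₂₃ k₁₂ k₁₃ k₂₃
  rw [Finset.sum_eq_zero] at this
  · norm_num at this
  · intro g _
    by_contra hne
    simp only [ind] at hne
    refine h g ?_ ?_ ?_ <;> by_contra h' <;> simp [h'] at hne

lemma exists_map_one (hG : IsSharp G) (a b : Fin 11) : ∃ g : G, (g : Perm (Fin 11)) a = b := by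
  by_contra! h
  have := sum_ind_one hG a b
  rw [Finset.sum_eq_zero] at this
  · norm_num at this
  · intro g _
    simp [ind, h g]

lemma agree_sq_sub (x y : Perm (Fin 11)) : agree x y * (agree x y - 1) =
    ∑ k, ∑ l, if k = l then 0 else ind y k (x k) * ind y l (x l) := by
  have h : ∀ k, (∑ l, if k = l then 0 else ind y k (x k) * ind y l (x l)) =
      ind y k (x k) * (agree x y - 1) := fun k ↦ by
    have e : ∀ l, (if k = l then 0 else ind y k (x k) * ind y l (x l)) =
        ind y k (x k) * ind y l (x l) - if k = l then ind y k (x k) else 0 := fun l ↦ by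
      split_ifs with hkl
      · subst hkl; rw [ind_mul_self]; simp
      · simp
    simp only [e, Finset.sum_sub_distrib, ← Finset.mul_sum, Finset.sum_ite_eq, Finset.mem_univ,
      if_true, agree]
    ring
  simp only [h, ← Finset.sum_mul]
  rfl

lemma agree_cube_sub (x y : Perm (Fin 11)) :
    agree x y * (agree x y - 1) * (agree x y - 2) =
    ∑ k, ∑ l, ∑ p, if k = l ∨ k = p ∨ l = p then 0 else
      ind y k (x k) * ind y l (x l) * ind y p (x p) := by
  rw [agree_sq_sub, Finset.sum_mul]
  refine Finset.sum_congr rfl fun k _ ↦ ?_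
  rw [Finset.sum_mul]
  refine Finset.sum_congr rfl fun l _ ↦ ?_
  by_cases hkl : k = l
  · simp [hkl]
  have e : ∀ p, (if k = l ∨ k = p ∨ l = p then 0 else
      ind y k (x k) * ind y l (x l) * ind y p (x p)) =
      ind y k (x k) * ind y l (x l) * ind y p (x p)
      - (if k = p then ind y k (x k) * ind y l (x l) else 0)
      - if l = p then ind y k (x k) * ind y l (x l) else 0 := fun p ↦ by
    by_cases hk : k = p
    · subst hk
      simp only [hkl, Ne.symm hkl, false_or, true_or, if_true, if_false]
      linear_combination (-ind y l (x l)) * ind_mul_self y k (x k)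
    · by_cases hl : l = p
      · subst hl
        simp only [hkl, or_true, if_true, if_false]
        linear_combination (-ind y k (x k)) * ind_mul_self y l (x l)
      · simp [hkl, hk, hl]
  rw [Finset.sum_congr rfl fun p _ ↦ e p]
  simp only [Finset.sum_sub_distrib, ← Finset.mul_sum, Finset.sum_ite_eq, Finset.mem_univ,
    if_true, agree, if_neg hkl]
  ring

lemma sum_ind_mul_agree (hG : IsSharp G) (x : G) {i j : Fin 11}
    (h : (x : Perm (Fin 11)) i ≠ j) : ∑ y : G, ind y i j * agree x y = 648 := by
  simp only [agree, Finset.mul_sum]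
  rw [Finset.sum_comm]
  obtain ⟨i', rfl⟩ := (x : Perm (Fin 11)).surjective j
  have hi : i ≠ i' := fun e ↦ h (by rw [e])
  rw [sum_eq_of_const_off (c := 72) {i, i'}]
  · rw [Finset.card_pair hi]; norm_num
  · intro k hk
    refine Finset.sum_eq_zero fun y _ ↦ ?_
    simp only [Finset.mem_insert, Finset.mem_singleton] at hk
    rcases hk with rfl | rfl
    · exact ind_mul_eq_zero_of_ne_right (Ne.symm h)
    · exact ind_mul_eq_zero_of_ne_left hi
  · intro k hk
    simp only [Finset.mem_insert, Finset.mem_singleton, not_or] at hk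
    exact sum_ind_two hG (Ne.symm hk.1) ((x : Perm (Fin 11)).injective.ne (Ne.symm hk.2))

lemma sum_ind_mul_agree_two (hG : IsSharp G) (x : G) {i j : Fin 11}
    (h : (x : Perm (Fin 11)) i ≠ j) :
    ∑ y : G, ind y i j * (agree x y * (agree x y - 1)) = 576 := by
  simp only [agree_sq_sub, Finset.mul_sum]
  rw [Finset.sum_comm]
  obtain ⟨i', rfl⟩ := (x : Perm (Fin 11)).surjective j
  have inj := (x : Perm (Fin 11)).injective
  have hi : i ≠ i' := fun e ↦ h (by rw [e])
  rw [sum_eq_of_const_off (c := 64) {i, i'}]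
  · rw [Finset.card_pair hi]; norm_num
  · intro k hk
    refine Finset.sum_eq_zero fun y _ ↦ Finset.sum_eq_zero fun l _ ↦ ?_
    simp only [Finset.mem_insert, Finset.mem_singleton] at hk
    have e : ind y i ((x : Perm (Fin 11)) i') * ind y k ((x : Perm (Fin 11)) k) = 0 := by
      rcases hk with rfl | rfl
      · exact ind_mul_eq_zero_of_ne_right (Ne.symm h)
      · exact ind_mul_eq_zero_of_ne_left hi
    rw [mul_ite, ← mul_assoc, e]
    simp
  · intro k hk
    simp only [Finset.mem_insert, Finset.mem_singleton, not_or] at hk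
    rw [Finset.sum_comm, sum_eq_of_const_off (c := 8) {i, i', k}]
    · rw [Finset.card_eq_three.2 ⟨i, i', k, hi, Ne.symm hk.1, Ne.symm hk.2, rfl⟩]; norm_num
    · intro l hl
      refine Finset.sum_eq_zero fun y _ ↦ ?_
      simp only [Finset.mem_insert, Finset.mem_singleton] at hl
      by_cases hkl : k = l
      · simp [hkl]
      have e : ind y i ((x : Perm (Fin 11)) i') * ind y l ((x : Perm (Fin 11)) l) = 0 := by
        rcases hl with rfl | rfl | rfl
        · exact ind_mul_eq_zero_of_ne_right (Ne.symm h)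
        · exact ind_mul_eq_zero_of_ne_left hi
        · exact absurd rfl hkl
      rw [if_neg hkl]
      linear_combination ind y k ((x : Perm (Fin 11)) k) * e
    · intro l hl
      simp only [Finset.mem_insert, Finset.mem_singleton, not_or] at hl
      obtain ⟨h₁, h₂, h₃⟩ := hl
      simp only [if_neg (Ne.symm h₃), ← mul_assoc]
      exact sum_ind_three hG (Ne.symm hk.1) (Ne.symm h₁) (Ne.symm h₃)
        (inj.ne (Ne.symm hk.2)) (inj.ne (Ne.symm h₂)) (inj.ne (Ne.symm h₃))

lemma sum_ind_mul_agree_three (hG : IsSharp G) (x : G) {i j : Fin 11}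
    (h : (x : Perm (Fin 11)) i ≠ j) :
    ∑ y : G, ind y i j * (agree x y * (agree x y - 1) * (agree x y - 2)) = 504 := by
  simp only [agree_cube_sub, Finset.mul_sum]
  rw [Finset.sum_comm]
  obtain ⟨i', rfl⟩ := (x : Perm (Fin 11)).surjective j
  have inj := (x : Perm (Fin 11)).injective
  have hi : i ≠ i' := fun e ↦ h (by rw [e])
  have key : ∀ (y : G) (k : Fin 11), k = i ∨ k = i' →
      ind y i ((x : Perm (Fin 11)) i') * ind y k ((x : Perm (Fin 11)) k) = 0 := by
    rintro y k (rfl | rfl)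
    · exact ind_mul_eq_zero_of_ne_right (Ne.symm h)
    · exact ind_mul_eq_zero_of_ne_left hi
  rw [sum_eq_of_const_off (c := 56) {i, i'}]
  · rw [Finset.card_pair hi]; norm_num
  · intro k hk
    refine Finset.sum_eq_zero fun y _ ↦ Finset.sum_eq_zero fun l _ ↦
      Finset.sum_eq_zero fun p _ ↦ ?_
    simp only [Finset.mem_insert, Finset.mem_singleton] at hk
    rw [mul_ite, ← mul_assoc, ← mul_assoc, key y k hk]
    simp
  · intro k hk
    simp only [Finset.mem_insert, Finset.mem_singleton, not_or] at hk
    rw [Finset.sum_comm, sum_eq_of_const_off (c := 7) {i, i', k}]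
    · rw [Finset.card_eq_three.2 ⟨i, i', k, hi, Ne.symm hk.1, Ne.symm hk.2, rfl⟩]; norm_num
    · intro l hl
      refine Finset.sum_eq_zero fun y _ ↦ Finset.sum_eq_zero fun p _ ↦ ?_
      simp only [Finset.mem_insert, Finset.mem_singleton] at hl
      by_cases hkl : k = l
      · simp [hkl]
      have e := key y l (by grind)
      split_ifs
      · simp
      · linear_combination ind y k ((x : Perm (Fin 11)) k) * ind y p ((x : Perm (Fin 11)) p) * e
    · intro l hl
      simp only [Finset.mem_insert, Finset.mem_singleton, not_or] at hl
      obtain ⟨h₁, h₂, h₃⟩ := hl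
      rw [Finset.sum_comm, sum_eq_of_const_off (c := 1) {i, i', k, l}]
      · rw [Finset.card_eq_four.2 ⟨i, i', k, l, hi, Ne.symm hk.1, Ne.symm h₁, Ne.symm hk.2,
          Ne.symm h₂, Ne.symm h₃, rfl⟩]
        norm_num
      · intro p hp
        refine Finset.sum_eq_zero fun y _ ↦ ?_
        simp only [Finset.mem_insert, Finset.mem_singleton] at hp
        split_ifs with hc
        · simp
        have e := key y p (by grind)
        linear_combination ind y k ((x : Perm (Fin 11)) k) * ind y l ((x : Perm (Fin 11)) l) * e
      · intro p hp
        simp only [Finset.mem_insert, Finset.mem_singleton, not_or] at hp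
        obtain ⟨g₁, g₂, g₃, g₄⟩ := hp
        have hc : ¬(k = l ∨ k = p ∨ l = p) := by grind
        simp only [if_neg hc, ← mul_assoc]
        exact sum_ind_four hG (Ne.symm hk.1) (Ne.symm h₁) (Ne.symm g₁) (Ne.symm h₃)
          (Ne.symm g₃) (Ne.symm g₄) (inj.ne (Ne.symm hk.2)) (inj.ne (Ne.symm h₂))
          (inj.ne (Ne.symm g₂)) (inj.ne (Ne.symm h₃)) (inj.ne (Ne.symm g₃))
          (inj.ne (Ne.symm g₄))

lemma sum_ind_mul_apart (hG : IsSharp G) (x : G) (i j : Fin 11) :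
    ∑ y : G, ind y i j * apart x y = 276 * (1 - ind x i j) := by
  by_cases h : (x : Perm (Fin 11)) i = j
  · rw [Finset.sum_eq_zero]
    · simp [ind, h]
    · intro y _
      simp only [ind, apart]
      split_ifs with h₁ h₂ <;> simp
      exact h₂ i (h₁.trans h.symm)
  · have e : ∀ y : G, ind y i j * apart x y = ind y i j - ind y i j * agree x y
        + ind y i j * (agree x y * (agree x y - 1)) / 2
        - ind y i j * (agree x y * (agree x y - 1) * (agree x y - 2)) / 6 := fun y ↦ by
      rw [apart_eq_poly hG]
      have : ind y i j * (if x = y then 120 else 0) = 0 := by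
        split_ifs with hxy
        · subst hxy; simp [ind, h]
        · simp
      linear_combination this
    simp only [e, Finset.sum_add_distrib, Finset.sum_sub_distrib, ← Finset.sum_div,
      sum_ind_one hG, sum_ind_mul_agree hG x h, sum_ind_mul_agree_two hG x h,
      sum_ind_mul_agree_three hG x h]
    simp only [ind, h]
    norm_num

lemma sum_agree_two (hG : IsSharp G) (x : G) :
    ∑ y : G, agree x y * (agree x y - 1) = 7920 := by
  simp only [agree_sq_sub]
  have inj := (x : Perm (Fin 11)).injective
  rw [Finset.sum_comm, sum_eq_of_const_off (c := 720) ∅ (by simp)]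
  · norm_num
  · intro k _
    rw [Finset.sum_comm, sum_eq_of_const_off (c := 72) {k}]
    · norm_num
    · simp
    · intro l hl
      rw [Finset.mem_singleton] at hl
      simp only [if_neg (Ne.symm hl)]
      exact sum_ind_two hG (Ne.symm hl) (inj.ne (Ne.symm hl))

lemma sum_agree_three (hG : IsSharp G) (x : G) :
    ∑ y : G, agree x y * (agree x y - 1) * (agree x y - 2) = 7920 := by
  simp only [agree_cube_sub]
  have inj := (x : Perm (Fin 11)).injective
  rw [Finset.sum_comm, sum_eq_of_const_off (c := 720) ∅ (by simp)]
  · norm_num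
  · intro k _
    rw [Finset.sum_comm, sum_eq_of_const_off (c := 72) {k}]
    · norm_num
    · simp
    · intro l hl
      rw [Finset.mem_singleton] at hl
      rw [Finset.sum_comm, sum_eq_of_const_off (c := 8) {k, l}]
      · rw [Finset.card_pair (Ne.symm hl)]; norm_num
      · intro p hp
        simp only [Finset.mem_insert, Finset.mem_singleton] at hp
        exact Finset.sum_eq_zero fun y _ ↦ if_pos (by grind)
      · intro p hp
        simp only [Finset.mem_insert, Finset.mem_singleton, not_or] at hp
        have hc : ¬(k = l ∨ k = p ∨ l = p) := by grind
        simp only [if_neg hc]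
        exact sum_ind_three hG (Ne.symm hl) (Ne.symm hp.1) (Ne.symm hp.2)
          (inj.ne (Ne.symm hl)) (inj.ne (Ne.symm hp.1)) (inj.ne (Ne.symm hp.2))

lemma sum_agree_eq_two (hG : IsSharp G) (x : G) :
    ∑ y : G, (if agree x y = 2 then (1 : ℝ) else 0) = 440 := by
  have e : ∀ y : G, (if agree x y = 2 then (1 : ℝ) else 0) = agree x y * (agree x y - 1) / 2
      - agree x y * (agree x y - 1) * (agree x y - 2) / 2 + if x = y then 440 else 0 := fun y ↦ by
    by_cases h : x = y
    · subst h; rw [agree_self]; norm_num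
    · rcases agree_of_ne hG h with h' | h' | h' | h' <;> rw [h'] <;> norm_num [h]
  simp only [e, Finset.sum_add_distrib, Finset.sum_sub_distrib, ← Finset.sum_div,
    sum_agree_two hG, sum_agree_three hG, Finset.sum_ite_eq, Finset.mem_univ, if_true]
  norm_num

lemma agree_comm (x y : Perm (Fin 11)) : agree x y = agree y x := by
  exact Finset.sum_congr rfl fun k _ ↦ if_congr eq_comm rfl rfl

lemma agree_eq_sum (x y : Perm (Fin 11)) :
    agree x y = ∑ p : Fin 11 × Fin 11, ind x p.1 p.2 * ind y p.1 p.2 := by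
  rw [agree_comm]
  simp [agree, ind, Fintype.sum_prod_type]

lemma sum_kernel_mul {α ι : Type*} [Fintype α] [Fintype ι] (φ : ι → α → ℝ) (f : α → ℝ) :
    ∑ x, ∑ y, (∑ a, φ a x * φ a y) * (f x * f y) = ∑ a, (∑ x, f x * φ a x) ^ 2 := by
  simp only [sq, Finset.sum_mul_sum]
  simp only [Finset.sum_mul]
  symm
  rw [Finset.sum_comm]
  refine Finset.sum_congr rfl fun x _ ↦ ?_
  rw [Finset.sum_comm]
  exact Finset.sum_congr rfl fun y _ ↦ Finset.sum_congr rfl fun a _ ↦ by ring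

/-- On functions orthogonal to the permutation module, the adjacency form of the derangement
graph is bounded below by `-520 / 3`. -/
lemma sum_apart_ge (hG : IsSharp G) (f : G → ℝ) (hf : ∀ i j, ∑ x : G, f x * ind x i j = 0) :
    -(520 / 3) * ∑ x, f x ^ 2 ≤ ∑ x : G, ∑ y : G, apart x y * (f x * f y) := by
  have e : ∀ x y : G, apart x y * (f x * f y) = f x * f y
      - (4 / 3) * (agree x y * (f x * f y))
      - (80 / 3) * (if x = y then f x * f y else 0) + (1 / 3) * (agree x y ^ 2 * (f x * f y))
      + (1 / 3) * ((if agree x y = 2 then 1 else 0) * (f x * f y)) := fun x y ↦ by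
    rw [apart_eq]
    by_cases h : x = y
    · subst h; rw [agree_self]; norm_num; ring
    · rcases agree_of_ne hG h with h' | h' | h' | h' <;> rw [h'] <;> norm_num [h] <;> ring
  have hf₀ : ∑ x, f x = 0 := by
    rw [sum_eq_sum_sum_mul_ind _ 0]; simp [hf]
  have h₂ : ∑ x : G, ∑ y : G, agree x y * (f x * f y) = 0 := by
    simp only [agree_eq_sum]
    rw [sum_kernel_mul (fun (p : Fin 11 × Fin 11) (x : G) ↦ ind x p.1 p.2)]
    simp [hf]
  have h₃ : 0 ≤ ∑ x : G, ∑ y : G, agree x y ^ 2 * (f x * f y) := by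
    have e₁ : ∀ x y : G, agree x y ^ 2 = ∑ q : (Fin 11 × Fin 11) × (Fin 11 × Fin 11),
        (ind x q.1.1 q.1.2 * ind x q.2.1 q.2.2) * (ind y q.1.1 q.1.2 * ind y q.2.1 q.2.2) :=
      fun x y ↦ by
        rw [sq, agree_eq_sum, Finset.sum_mul_sum]
        simp only [Fintype.sum_prod_type, mul_mul_mul_comm]
    simp only [e₁]
    rw [sum_kernel_mul (fun (q : (Fin 11 × Fin 11) × (Fin 11 × Fin 11)) (x : G) ↦
      ind x q.1.1 q.1.2 * ind x q.2.1 q.2.2)]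
    exact Finset.sum_nonneg fun q _ ↦ sq_nonneg _
  have h₄ : -440 * ∑ x, f x ^ 2 ≤
      ∑ x : G, ∑ y : G, (if agree x y = 2 then 1 else 0) * (f x * f y) := by
    have e₁ : ∑ x : G, ∑ y : G, (if agree x y = 2 then (1 : ℝ) else 0) * f x ^ 2 =
        440 * ∑ x, f x ^ 2 := by
      simp only [← Finset.sum_mul, sum_agree_eq_two hG, ← Finset.mul_sum]
    have e₂ : ∑ x : G, ∑ y : G, (if agree x y = 2 then (1 : ℝ) else 0) * f y ^ 2 =
        440 * ∑ x, f x ^ 2 := by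
      rw [Finset.sum_comm, ← e₁]
      simp only [agree_comm]
    have e₃ : ∀ x y : G, -((if agree x y = 2 then (1 : ℝ) else 0) * f x ^ 2) / 2
        - ((if agree x y = 2 then (1 : ℝ) else 0) * f y ^ 2) / 2 ≤
        (if agree x y = 2 then 1 else 0) * (f x * f y) := fun x y ↦ by
      split_ifs
      · nlinarith [sq_nonneg (f x + f y)]
      · simp
    have := Finset.sum_le_sum fun x (_ : x ∈ univ) ↦
      Finset.sum_le_sum fun y (_ : y ∈ univ) ↦ e₃ x y
    refine le_trans (le_of_eq ?_) this
    simp only [Finset.sum_sub_distrib, ← Finset.sum_div, Finset.sum_neg_distrib, e₁, e₂]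
    ring
  have h₅ : ∑ x : G, ∑ y : G, (if x = y then f x * f y else 0) = ∑ x, f x ^ 2 := by
    simp [sq]
  simp only [e, Finset.sum_add_distrib, Finset.sum_sub_distrib, ← Finset.mul_sum, hf₀, h₂, h₅,
    mul_zero, Finset.sum_const_zero]
  linarith

lemma sum_ind_mul_ind (hG : IsSharp G) (i j k l : Fin 11) :
    ∑ x : G, ind x k l * ind x i j = 72 - 72 * (if k = i then 1 else 0)
      - 72 * (if l = j then 1 else 0)
      + 792 * ((if k = i then 1 else 0) * (if l = j then 1 else 0)) := by
  by_cases h : k = i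
  · subst h
    by_cases h' : l = j
    · subst h'
      simp only [ind_mul_self, sum_ind_one hG]
      norm_num
    · simp [h', ind_mul_eq_zero_of_ne_right h']
  · by_cases h' : l = j
    · subst h'
      simp [h, ind_mul_eq_zero_of_ne_left h]
    · rw [sum_ind_two hG h h']
      simp [h, h']

/-- The total weight of `f` on the elements mapping `i` to `j`. -/
noncomputable def marg (f : G → ℝ) (i j : Fin 11) : ℝ := ∑ x : G, f x * ind x i j

/-- The orthogonal projection of `f` to the permutation module. -/
noncomputable def proj (f : G → ℝ) (x : G) : ℝ :=
  (∑ i, ∑ j, marg f i j * ind x i j) / 792 - (∑ y, f y) / 880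

lemma sum_marg_right (f : G → ℝ) (i : Fin 11) : ∑ j, marg f i j = ∑ x, f x :=
  (sum_eq_sum_sum_mul_ind f i).symm

lemma sum_marg_left (f : G → ℝ) (j : Fin 11) : ∑ i, marg f i j = ∑ x, f x := by
  simp only [marg]
  rw [Finset.sum_comm]
  simp only [← Finset.mul_sum, sum_ind_left, mul_one]

lemma sum_mul_proj (w f : G → ℝ) : ∑ x, w x * proj f x =
    (∑ i, ∑ j, marg f i j * marg w i j) / 792 - (∑ y, f y) / 880 * ∑ x, w x := by
  simp only [proj, marg, mul_sub, Finset.sum_sub_distrib]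
  congr 1
  · simp only [← mul_div_assoc, ← Finset.sum_div, Finset.mul_sum (s := (univ : Finset (Fin 11)))]
    congr 1
    rw [Finset.sum_comm]
    refine Finset.sum_congr rfl fun i _ ↦ ?_
    rw [Finset.sum_comm]
    refine Finset.sum_congr rfl fun j _ ↦ ?_
    rw [Finset.mul_sum]
    exact Finset.sum_congr rfl fun x _ ↦ by ring
  · rw [← Finset.sum_mul, mul_comm]

lemma marg_proj (hG : IsSharp G) (f : G → ℝ) (i j : Fin 11) :
    marg (proj f) i j = marg f i j := by
  have h₁ : marg (proj f) i j = ∑ x : G, ind x i j * proj f x := by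
    simp only [marg, mul_comm]
  have h₂ : ∀ k l, marg (fun x : G ↦ ind x i j) k l = 72 - 72 * (if k = i then 1 else 0)
      - 72 * (if l = j then 1 else 0)
      + 792 * ((if k = i then 1 else 0) * (if l = j then 1 else 0)) := fun k l ↦ by
    rw [← sum_ind_mul_ind hG]
    simp only [marg, mul_comm]
  have h₃ : ∑ k, ∑ l, marg f k l * (72 - 72 * (if k = i then 1 else 0)
      - 72 * (if l = j then 1 else 0)
      + 792 * ((if k = i then 1 else 0) * (if l = j then 1 else 0))) =
      648 * (∑ x, f x) + 792 * marg f i j := by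
    have : ∀ k l, marg f k l * (72 - 72 * (if k = i then 1 else 0)
      - 72 * (if l = j then 1 else 0)
      + 792 * ((if k = i then 1 else 0) * (if l = j then 1 else 0))) =
      72 * marg f k l - 72 * (if k = i then marg f k l else 0)
      - 72 * (if l = j then marg f k l else 0)
      + 792 * (if k = i then (if l = j then marg f k l else 0) else 0) := fun k l ↦ by
      split_ifs <;> ring
    have h₄ : ∑ k, ∑ l, (if k = i then marg f k l else 0) = ∑ x, f x := by
      rw [Finset.sum_comm]; simp [sum_marg_right]
    have h₅ : ∑ k, ∑ l, (if k = i then (if l = j then marg f k l else 0) else 0) =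
        marg f i j := by
      rw [Finset.sum_comm]; simp
    simp only [this, Finset.sum_add_distrib, Finset.sum_sub_distrib, ← Finset.mul_sum, h₄, h₅,
      Finset.sum_ite_eq', Finset.mem_univ, if_true, sum_marg_left, sum_marg_right,
      Finset.sum_const, Finset.card_univ, Fintype.card_fin]
    simp only [nsmul_eq_mul]
    push_cast
    ring
  rw [h₁, sum_mul_proj]
  simp only [h₂, h₃, sum_ind_one hG]
  ring

lemma sum_apart (hG : IsSharp G) (x : G) : ∑ y : G, apart x y = 2760 := by
  rw [sum_eq_sum_sum_mul_ind _ 0]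
  simp only [mul_comm (apart _ _), sum_ind_mul_apart hG, ← Finset.mul_sum,
    Finset.sum_sub_distrib, sum_ind_right]
  norm_num

lemma sum_apart_mul_proj (hG : IsSharp G) (f : G → ℝ) (x : G) :
    ∑ y : G, apart x y * proj f y = 276 * ((∑ y, f y) / 720 - proj f x) := by
  have h : ∀ i j, marg (fun y : G ↦ apart x y) i j = 276 * (1 - ind x i j) := fun i j ↦ by
    rw [← sum_ind_mul_apart hG]
    simp only [marg, mul_comm]
  have h' : ∀ i j, marg f i j * (276 * (1 - ind x i j)) =
      276 * marg f i j - 276 * (marg f i j * ind x i j) := fun i j ↦ by ring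
  rw [sum_mul_proj, sum_apart hG, proj]
  simp only [h, h', Finset.sum_sub_distrib, ← Finset.mul_sum, sum_marg_right,
    Finset.sum_const, Finset.card_univ, Fintype.card_fin]
  simp only [nsmul_eq_mul]
  push_cast
  ring

/-- The ratio bound for the derangement graph, with its defect. -/
lemma ratio_bound (hG : IsSharp G) (f : G → ℝ)
    (hf : ∑ x : G, ∑ y : G, apart x y * (f x * f y) = 0) :
    308 / 3 * ∑ x, (f x - proj f x) ^ 2 ≤ 276 * (∑ x, f x ^ 2 - (∑ x, f x) ^ 2 / 720) := by
  set h : G → ℝ := fun x ↦ f x - proj f x with h_def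
  have hm : ∀ i j, marg h i j = 0 := fun i j ↦ by
    have := marg_proj hG f i j
    simp only [marg, h_def, sub_mul, Finset.sum_sub_distrib] at this ⊢
    rw [this, sub_self]
  have hs : ∑ x, h x = 0 := by
    rw [← sum_marg_right h 0]; simp [hm]
  have hs' : ∑ x, proj f x = ∑ x, f x := by
    have : ∑ x, h x = ∑ x, f x - ∑ x, proj f x := by
      simp only [h_def, Finset.sum_sub_distrib]
    linarith
  have hp : ∑ x, h x * proj f x = 0 := by
    rw [sum_mul_proj]; simp [hm, hs]
  have hQ := sum_apart_ge hG h hm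
  have e₁ : ∀ w : G → ℝ, ∑ x : G, ∑ y : G, apart x y * (w x * proj f y) =
      276 * ((∑ x, w x) * (∑ x, f x) / 720 - ∑ x, w x * proj f x) := fun w ↦ by
    have : ∀ x : G, ∑ y : G, apart x y * (w x * proj f y) =
        276 / 720 * (∑ y, f y) * w x - 276 * (w x * proj f x) := fun x ↦ by
      have : ∀ y : G, apart x y * (w x * proj f y) = w x * (apart x y * proj f y) :=
        fun y ↦ by ring
      simp only [this, ← Finset.mul_sum, sum_apart_mul_proj hG]
      ring
    simp only [this, Finset.sum_sub_distrib, ← Finset.mul_sum]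
    ring
  have e₂ : ∑ x : G, ∑ y : G, apart x y * (proj f x * f y) =
      ∑ x : G, ∑ y : G, apart x y * (f x * proj f y) := by
    rw [Finset.sum_comm]
    exact Finset.sum_congr rfl fun y _ ↦ Finset.sum_congr rfl fun x _ ↦ by
      rw [apart_comm, mul_comm (proj f _)]
  have e₃ : ∑ x : G, ∑ y : G, apart x y * (h x * h y) =
      276 * (∑ x, proj f x * proj f x) - 276 * (∑ x, f x) ^ 2 / 720 := by
    have : ∀ x y : G, apart x y * (h x * h y) = apart x y * (f x * f y)
        - apart x y * (f x * proj f y) - apart x y * (proj f x * f y)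
        + apart x y * (proj f x * proj f y) := fun x y ↦ by simp only [h_def]; ring
    have hfp : ∑ x, f x * proj f x = ∑ x, proj f x * proj f x := by
      have : ∑ x, h x * proj f x = ∑ x, f x * proj f x - ∑ x, proj f x * proj f x := by
        simp only [h_def, sub_mul, Finset.sum_sub_distrib]
      linarith
    simp only [this, Finset.sum_add_distrib, Finset.sum_sub_distrib, hf, e₂, e₁, hs', hfp]
    ring
  have e₄ : ∑ x, f x ^ 2 = ∑ x, h x ^ 2 + ∑ x, proj f x * proj f x := by
    have : ∀ x, f x ^ 2 = h x ^ 2 + 2 * (h x * proj f x) + proj f x * proj f x := fun x ↦ by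
      simp only [h_def]; ring
    simp only [this, Finset.sum_add_distrib, ← Finset.mul_sum, hp]
    ring
  have : ∑ x, (f x - proj f x) ^ 2 = ∑ x, h x ^ 2 := rfl
  linarith

/-- The number of derangements in `G` mapping `i` to `j` and `k` to `l`. -/
noncomputable def numApart (G : Subgroup (Perm (Fin 11))) [Fintype G] (i j k l : Fin 11) : ℝ :=
  ∑ y : G, apart 1 y * ind y i j * ind y k l

lemma apart_one_mul_ind (y : Perm (Fin 11)) (k : Fin 11) : apart 1 y * ind y k k = 0 := by
  simp only [apart, ind]
  split_ifs with h₁ h₂ <;> simp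
  exact h₁ k (by simpa using h₂)

lemma numApart_conj (h : G) (i j k l : Fin 11) :
    numApart G ((h : Perm (Fin 11)) i) ((h : Perm (Fin 11)) j) ((h : Perm (Fin 11)) k)
      ((h : Perm (Fin 11)) l) = numApart G i j k l := by
  unfold numApart
  symm
  refine Fintype.sum_equiv (MulAut.conj h).toEquiv _ _ fun y ↦ ?_
  have e₁ : ∀ a b, ind ((MulAut.conj h).toEquiv y : G) ((h : Perm (Fin 11)) a)
      ((h : Perm (Fin 11)) b) = ind y a b := fun a b ↦ by
    simp [ind]
  have e₂ : apart 1 ((MulAut.conj h).toEquiv y : G) = apart 1 y := by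
    unfold apart
    refine if_congr ?_ rfl rfl
    rw [← (h : Perm (Fin 11)).forall_congr_right]
    simp
  rw [e₁, e₁, e₂]

lemma sum_numApart (hG : IsSharp G) {i j : Fin 11} (h : i ≠ j) (k : Fin 11) :
    ∑ l, numApart G i j k l = 276 := by
  have := sum_ind_mul_apart hG 1 i j
  rw [sum_eq_sum_sum_mul_ind _ k] at this
  simp only [numApart]
  simp only [mul_comm (ind _ i j), OneMemClass.coe_one] at this
  rw [this]
  simp [ind, h]

lemma sum_numApart' (hG : IsSharp G) {i j : Fin 11} (h : i ≠ j) (l : Fin 11) :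
    ∑ k, numApart G i j k l = 276 := by
  have := sum_ind_mul_apart hG 1 i j
  simp only [numApart]
  rw [Finset.sum_comm]
  simp only [← Finset.mul_sum, sum_ind_left, mul_one]
  simp only [mul_comm (ind _ i j), OneMemClass.coe_one] at this
  rw [this]
  simp [ind, h]

lemma sum_eq_add_of_const_off {f : Fin 11 → ℝ} {c : ℝ} {i : Fin 11} (t : Finset (Fin 11))
    (hi : i ∉ t) (h₀ : ∀ x ∈ t, f x = 0) (h : ∀ x, x ∉ t → x ≠ i → f x = c) :
    ∑ x, f x = f i + (10 - #t) * c := by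
  have := sum_eq_of_const_off (f := fun x ↦ f x - if x = i then f i else 0) (c := c) (insert i t)
    (fun x hx ↦ by
      rcases Finset.mem_insert.1 hx with rfl | hx
      · simp
      · simp [h₀ x hx, ne_of_mem_of_not_mem hx hi])
    (fun x hx ↦ by
      rw [Finset.mem_insert, not_or] at hx
      simp [hx.1, h x hx.2 hx.1])
  rw [Finset.card_insert_of_notMem hi, Finset.sum_sub_distrib] at this
  simp only [Finset.sum_ite_eq', Finset.mem_univ, if_true] at this
  push_cast at this
  linarith

lemma numApart_self (hG : IsSharp G) {i j : Fin 11} (h : i ≠ j) : numApart G i j i j = 276 := by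
  have := sum_ind_mul_apart hG 1 i j
  simp only [numApart, mul_assoc, ind_mul_self]
  simp only [mul_comm (ind _ i j), OneMemClass.coe_one] at this
  rw [this]
  simp [ind, h]

lemma numApart_fixed (i j k : Fin 11) : numApart G i j k k = 0 :=
  Finset.sum_eq_zero fun y _ ↦ by
    linear_combination ind y i j * apart_one_mul_ind y k

lemma numApart_of_ne_right {i j l : Fin 11} (h : j ≠ l) : numApart G i j i l = 0 :=
  Finset.sum_eq_zero fun y _ ↦ by
    rw [mul_assoc, ind_mul_eq_zero_of_ne_right h, mul_zero]

lemma numApart_of_ne_left {i j k : Fin 11} (h : i ≠ k) : numApart G i j k j = 0 :=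
  Finset.sum_eq_zero fun y _ ↦ by
    rw [mul_assoc, ind_mul_eq_zero_of_ne_left h, mul_zero]

lemma numApart_swap_comm (i j : Fin 11) : numApart G i j j i = numApart G j i i j :=
  Finset.sum_congr rfl fun y _ ↦ by ring

lemma apart_nonneg (x y : Perm (Fin 11)) : 0 ≤ apart x y := by
  unfold apart; split_ifs <;> simp

lemma apart_le_one (x y : Perm (Fin 11)) : apart x y ≤ 1 := by
  unfold apart; split_ifs <;> simp

lemma numApart_nonneg (i j k l : Fin 11) : 0 ≤ numApart G i j k l :=
  Finset.sum_nonneg fun _ _ ↦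
    mul_nonneg (mul_nonneg (apart_nonneg _ _) (ind_nonneg _ _ _)) (ind_nonneg _ _ _)

lemma numApart_swap_le (hG : IsSharp G) {i j : Fin 11} (h : i ≠ j) :
    numApart G i j j i ≤ 72 := by
  rw [← sum_ind_two hG h h.symm]
  refine Finset.sum_le_sum fun _ _ ↦ ?_
  rw [mul_assoc]
  exact mul_le_of_le_one_left (mul_nonneg (ind_nonneg _ _ _) (ind_nonneg _ _ _))
    (apart_le_one _ _)

lemma numApart_succ (hG : IsSharp G) {i j l : Fin 11} (h : i ≠ j) (hi : l ≠ i) (hj : l ≠ j) :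
    9 * numApart G i j j l = 276 - numApart G i j j i := by
  have := sum_numApart hG h j
  rw [sum_eq_add_of_const_off (c := numApart G i j j l) {j} (i := i) (by simpa using h)] at this
  · rw [Finset.card_singleton] at this
    push_cast at this
    linarith
  · intro x hx
    rw [Finset.mem_singleton] at hx
    rw [hx, numApart_fixed]
  · intro x hx hxi
    rw [Finset.mem_singleton] at hx
    obtain ⟨g, e₁, e₂, e₃⟩ := exists_map_three hG h hi.symm hj.symm h (Ne.symm hxi) (Ne.symm hx)
    rw [← numApart_conj g i j j l, e₁, e₂, e₃]

lemma numApart_pred (hG : IsSharp G) {i j k : Fin 11} (h : i ≠ j) (hi : k ≠ i) (hj : k ≠ j) :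
    9 * numApart G i j k i = 276 - numApart G i j j i := by
  have := sum_numApart' hG h i
  rw [sum_eq_add_of_const_off (c := numApart G i j k i) {i} (i := j) (by simpa using h.symm)]
    at this
  · rw [Finset.card_singleton] at this
    push_cast at this
    linarith
  · intro x hx
    rw [Finset.mem_singleton] at hx
    rw [hx, numApart_fixed]
  · intro x hx hxj
    rw [Finset.mem_singleton] at hx
    obtain ⟨g, e₁, e₂, e₃⟩ := exists_map_three hG h hi.symm hj.symm h (Ne.symm hx) (Ne.symm hxj)
    rw [← numApart_conj g i j k i, e₁, e₂, e₃]

lemma numApart_disjoint (hG : IsSharp G) {i j k l : Fin 11} (h : i ≠ j) (hki : k ≠ i)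
    (hkj : k ≠ j) (hli : l ≠ i) (hlj : l ≠ j) (hkl : k ≠ l) :
    8 * numApart G i j k l = 276 - numApart G i j k i := by
  have := sum_numApart hG h k
  rw [sum_eq_add_of_const_off (c := numApart G i j k l) {k, j} (i := i)
    (by simp [h, hki.symm])] at this
  · rw [Finset.card_pair hkj] at this
    push_cast at this
    linarith
  · intro x hx
    rw [Finset.mem_insert, Finset.mem_singleton] at hx
    rcases hx with rfl | rfl
    · exact numApart_fixed _ _ _
    · exact numApart_of_ne_left hki.symm
  · intro x hx hxi
    rw [Finset.mem_insert, Finset.mem_singleton, not_or] at hx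
    obtain ⟨g, ⟨e₁, e₂, e₃, e₄⟩, -⟩ := hG i j k l i j k x h hki.symm hli.symm hkj.symm hlj.symm
      hkl h hki.symm (Ne.symm hxi) hkj.symm (Ne.symm hx.2) (Ne.symm hx.1)
    rw [← numApart_conj g i j k l, e₁, e₂, e₃, e₄]

lemma relation_of_sum_eq_zero (hG : IsSharp G) {N : Fin 11 → Fin 11 → ℝ}
    (hN : ∀ i, N i i = 0) (hr : ∀ i, ∑ j, N i j = 0) (hc : ∀ j, ∑ i, N i j = 0)
    (hd : ∀ y : G, (∀ k, (y : Perm (Fin 11)) k ≠ k) → ∑ i, N i ((y : Perm (Fin 11)) i) = 0)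
    {a u v : ℝ} {i j : Fin 11} (h : i ≠ j) (ha : numApart G i j j i = a) (hu : 9 * u = 276 - a)
    (hv : 8 * v = 276 - u) : (276 + v) * N i j + (a - 2 * u + v) * N j i = 0 := by
  have h₁ : ∑ k, ∑ l, N k l * numApart G i j k l = 0 := by
    have e : ∀ k l, N k l * numApart G i j k l =
        ∑ y : G, apart 1 y * ind y i j * (N k l * ind y k l) := fun k l ↦ by
      rw [numApart, Finset.mul_sum]
      exact Finset.sum_congr rfl fun y _ ↦ by ring
    simp only [e, Finset.sum_comm (s := (univ : Finset (Fin 11))) (t := (univ : Finset G))]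
    refine Finset.sum_eq_zero fun y _ ↦ ?_
    simp only [← Finset.mul_sum, sum_ind_mul]
    by_cases hy : ∀ k, (y : Perm (Fin 11)) k ≠ k
    · rw [hd y hy, mul_zero]
    · have : apart 1 (y : Perm (Fin 11)) = 0 := if_neg hy
      rw [this, zero_mul, zero_mul]
  have h₂ : ∀ k l, N k l * numApart G i j k l = v * N k l
      - v * (if k = i then N k l else 0) - v * (if l = j then N k l else 0)
      + (u - v) * (if k = j then N k l else 0) + (u - v) * (if l = i then N k l else 0)
      + (276 + v) * (if k = i then (if l = j then N k l else 0) else 0)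
      + (a - 2 * u + v) * (if k = j then (if l = i then N k l else 0) else 0) := fun k l ↦ by
    by_cases hkl : k = l
    · subst hkl; simp [hN]
    by_cases hki : k = i
    · subst hki
      by_cases hlj : l = j
      · subst hlj
        rw [numApart_self hG h]
        simp [h, h.symm]
        ring
      · rw [numApart_of_ne_right (Ne.symm hlj)]
        simp [h, hlj, Ne.symm hkl]
    by_cases hlj : l = j
    · subst hlj
      rw [numApart_of_ne_left (Ne.symm hki)]
      simp [hki, hkl, h.symm]
    by_cases hkj : k = j
    · subst hkj
      by_cases hli : l = i
      · subst hli
        rw [ha]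
        simp [h, h.symm]
        ring
      · have := numApart_succ hG h hli hlj
        have e : numApart G i k k l = u := by linarith
        rw [e]
        simp [hki, hlj, hli]
        ring
    · by_cases hli : l = i
      · subst hli
        have := numApart_pred hG h hki hkj
        have e : numApart G l j k l = u := by linarith
        rw [e]
        simp [hkl, h, hkj]
        ring
      · have e₁ := numApart_pred hG h hki hkj
        have e₂ := numApart_disjoint hG h hki hkj hli hlj hkl
        have e : numApart G i j k l = v := by linarith
        rw [e]
        simp [hki, hkj, hli, hlj]
        ring
  have h₃ : ∀ p, ∑ k, ∑ l, (if k = p then N k l else 0) = 0 := fun p ↦ by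
    rw [Finset.sum_comm]; simp [hr]
  have h₄ : ∀ p q, ∑ k, ∑ l, (if k = p then (if l = q then N k l else 0) else 0) = N p q :=
    fun p q ↦ by rw [Finset.sum_comm]; simp
  simp only [h₂, Finset.sum_add_distrib, Finset.sum_sub_distrib, ← Finset.mul_sum, h₃, h₄,
    Finset.sum_ite_eq', Finset.mem_univ, if_true, hr, hc, Finset.sum_const_zero] at h₁
  linarith

/-- The derangements of `G` determine a matrix up to row and column corrections. -/
lemma eq_zero_of_sum_eq_zero (hG : IsSharp G) {N : Fin 11 → Fin 11 → ℝ}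
    (hN : ∀ i, N i i = 0) (hr : ∀ i, ∑ j, N i j = 0) (hc : ∀ j, ∑ i, N i j = 0)
    (hd : ∀ y : G, (∀ k, (y : Perm (Fin 11)) k ≠ k) → ∑ i, N i ((y : Perm (Fin 11)) i) = 0)
    (i j : Fin 11) : N i j = 0 := by
  by_cases h : i = j
  · rw [h, hN]
  obtain ⟨a, ha⟩ : ∃ a, numApart G i j j i = a := ⟨_, rfl⟩
  have h₁ := relation_of_sum_eq_zero hG hN hr hc hd (a := a) (u := (276 - a) / 9)
    (v := (276 - (276 - a) / 9) / 8) h ha (by ring) (by ring)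
  have h₂ := relation_of_sum_eq_zero hG hN hr hc hd (a := a) (u := (276 - a) / 9)
    (v := (276 - (276 - a) / 9) / 8) (Ne.symm h) (by rw [← numApart_swap_comm, ha])
    (by ring) (by ring)
  have ha₀ : 0 ≤ a := ha ▸ numApart_nonneg i j j i
  have ha₁ : a ≤ 72 := ha ▸ numApart_swap_le hG h
  have hs : N i j + N j i = 0 := by
    have : (276 + a + 2 * ((276 - (276 - a) / 9) / 8) - 2 * ((276 - a) / 9)) *
      (N i j + N j i) = 0 := by linear_combination h₁ + h₂
    exact (mul_eq_zero.1 this).resolve_left (by intro e; linarith)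
  have ht : N i j - N j i = 0 := by
    have : (276 - a + 2 * ((276 - a) / 9)) * (N i j - N j i) = 0 := by
      linear_combination h₁ - h₂
    exact (mul_eq_zero.1 this).resolve_left (by intro e; linarith)
  linarith

lemma exists_fixes_only (hG : IsSharp G) (i : Fin 11) :
    ∃ y : G, ∀ k, (y : Perm (Fin 11)) k = k ↔ k = i := by
  have hcard : Fintype.card G = 7920 := by exact_mod_cast card_eq hG
  have : Fact (Nat.Prime 5) := ⟨by norm_num⟩
  obtain ⟨g, hg⟩ := exists_prime_orderOf_dvd_card 5 (G := G) (by rw [hcard]; norm_num)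
  have hg₁ : (1 : G) ≠ g := by
    rintro rfl
    simp at hg
  have hmod : #{k | (g : Perm (Fin 11)) k = k} % 5 = 1 := by
    have := Perm.card_compl_support_modEq (σ := (g : Perm (Fin 11))) (p := 5) (n := 1) (by
      rw [pow_one, ← hg, ← Subgroup.coe_pow, pow_orderOf_eq_one, Subgroup.coe_one])
    have e : (g : Perm (Fin 11)).supportᶜ =
        ({k | (g : Perm (Fin 11)) k = k} : Finset (Fin 11)) := by
      ext k; simp
    rw [e] at this
    exact this
  have hone : #{k | (g : Perm (Fin 11)) k = k} = 1 := by
    have h : #{k | (g : Perm (Fin 11)) k = k} ≤ 3 := card_eq_le_three hG hg₁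
    omega
  obtain ⟨j, hj⟩ := Finset.card_eq_one.1 hone
  obtain ⟨h, rfl⟩ := exists_map_one hG j i
  refine ⟨h * g * h⁻¹, fun k ↦ ?_⟩
  obtain ⟨k, rfl⟩ := (h : Perm (Fin 11)).surjective k
  have := congrArg (k ∈ ·) hj
  simpa using this

lemma eq_filter_of_one_mem (hG : IsSharp G) (S : Finset G) (h₁ : 1 ∈ S)
    (hS : ∀ y ∈ S, ∃ k, (y : Perm (Fin 11)) k = k) (hcard : #S = 720)
    (hp : ∀ x, (if x ∈ S then (1 : ℝ) else 0) = proj (fun x : G ↦ if x ∈ S then 1 else 0) x) :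
    ∃ i : Fin 11, S = univ.filter (fun g : G ↦ (g : Perm (Fin 11)) i = i) := by
  set f : G → ℝ := fun x ↦ if x ∈ S then 1 else 0 with hf
  have hs : ∑ x, f x = 720 := by simp [hf, hcard]
  have hF : ∀ x : G, ∑ i, marg f i ((x : Perm (Fin 11)) i) = 792 * f x + 648 := fun x ↦ by
    have := hp x
    simp only [proj, sum_ind_mul, hs] at this
    linarith
  have hdiag : ∑ i, marg f i i = 1440 := by
    have := hF 1
    simp only [OneMemClass.coe_one, Perm.coe_one, id, hf, if_pos h₁] at this
    linarith
  have hN := eq_zero_of_sum_eq_zero hG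
    (N := fun i j ↦ marg f i j + (marg f i i + marg f j j) / 9 - 88
      - if i = j then 11 / 9 * marg f i i - 88 else 0)
    (fun i ↦ by simp; ring)
    (fun i ↦ by
      simp only [Finset.sum_add_distrib, Finset.sum_sub_distrib, ← Finset.sum_div,
        sum_marg_right, hs, hdiag, Finset.sum_const, Finset.card_univ, Fintype.card_fin,
        Finset.sum_ite_eq, Finset.mem_univ, if_true]
      simp only [nsmul_eq_mul]
      push_cast
      ring)
    (fun j ↦ by
      simp only [Finset.sum_add_distrib, Finset.sum_sub_distrib, ← Finset.sum_div,
        sum_marg_left, hs, hdiag, Finset.sum_const, Finset.card_univ, Fintype.card_fin,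
        Finset.sum_ite_eq', Finset.mem_univ, if_true]
      simp only [nsmul_eq_mul]
      push_cast
      ring)
    (fun y hy ↦ by
      have hyS : y ∉ S := fun h ↦ by
        obtain ⟨k, hk⟩ := hS y h
        exact hy k hk
      simp only [Finset.sum_add_distrib, Finset.sum_sub_distrib, ← Finset.sum_div, hF,
        hdiag, Equiv.sum_comp (y : Perm (Fin 11)) (fun i ↦ marg f i i), Finset.sum_const,
        Finset.card_univ, Fintype.card_fin, if_neg (Ne.symm (hy _))]
      simp only [nsmul_eq_mul, hf, if_neg hyS]
      norm_num)
  have hfix : ∀ i, marg f i i = 720 ∨ marg f i i = 72 := fun i ↦ by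
    obtain ⟨y, hy⟩ := exists_fixes_only hG i
    have h := Finset.sum_congr rfl fun k (_ : k ∈ univ) ↦ hN k ((y : Perm (Fin 11)) k)
    simp only [Finset.sum_add_distrib, Finset.sum_sub_distrib, ← Finset.sum_div, hF,
        hdiag, Equiv.sum_comp (y : Perm (Fin 11)) (fun i ↦ marg f i i), Finset.sum_const,
        Finset.card_univ, Fintype.card_fin, eq_comm (b := (y : Perm (Fin 11)) _), hy,
        Finset.sum_ite_eq', Finset.mem_univ, if_true] at h
    simp only [nsmul_eq_mul, hf] at h
    by_cases hyS : y ∈ S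
    · rw [if_pos hyS] at h
      left
      norm_num at h
      linarith
    · rw [if_neg hyS] at h
      right
      norm_num at h
      linarith
  obtain ⟨i, hi⟩ : ∃ i, marg f i i = 720 := by
    by_contra! h
    have : ∀ i, marg f i i = 72 := fun i ↦ (hfix i).resolve_left (h i)
    simp only [this] at hdiag
    norm_num at hdiag
  have e₁ : #(univ.filter fun g : G ↦ (g : Perm (Fin 11)) i = i) = 720 := by
    have := sum_ind_one hG i i
    simp only [ind, Finset.sum_boole] at this
    exact_mod_cast this
  have e₂ : #(S ∩ univ.filter fun g : G ↦ (g : Perm (Fin 11)) i = i) = 720 := by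
    simp only [marg, ind, hf, ← ite_and, mul_ite, mul_one, mul_zero] at hi
    rw [Finset.sum_boole] at hi
    have hi' : #(univ.filter fun g : G ↦ (g : Perm (Fin 11)) i = i ∧ g ∈ S) = 720 := by
      exact_mod_cast hi
    rw [← hi']
    congr 1
    ext g
    simp [and_comm]
  have e₃ := Finset.eq_of_subset_of_card_le
    (Finset.inter_subset_left (s₁ := S) (s₂ := univ.filter fun g : G ↦ (g : Perm (Fin 11)) i = i))
    (by rw [e₂, hcard])
  have e₄ := Finset.eq_of_subset_of_card_le
    (Finset.inter_subset_right (s₁ := S) (s₂ := univ.filter fun g : G ↦ (g : Perm (Fin 11)) i = i))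
    (by rw [e₂, e₁])
  exact ⟨i, e₃.symm.trans e₄⟩

/-- The defect in the ratio bound for an intersecting set. -/
lemma ratio_bound_of_intersecting (hG : IsSharp G) (S : Finset G)
    (hS : ∀ π ∈ S, ∀ σ ∈ S, ∃ x : Fin 11, ((π * σ⁻¹ : G) : Perm (Fin 11)) x = x) :
    308 / 3 * ∑ x, ((if x ∈ S then (1 : ℝ) else 0)
      - proj (fun x : G ↦ if x ∈ S then 1 else 0) x) ^ 2 ≤ 276 * (#S - (#S : ℝ) ^ 2 / 720) := by
  have h := ratio_bound hG (fun x ↦ if x ∈ S then 1 else 0) (by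
    refine Finset.sum_eq_zero fun x _ ↦ Finset.sum_eq_zero fun y _ ↦ ?_
    by_cases hx : x ∈ S
    · by_cases hy : y ∈ S
      · obtain ⟨k, hk⟩ := hS y hy x hx
        obtain ⟨k, rfl⟩ := (x : Perm (Fin 11)).surjective k
        have : apart (x : Perm (Fin 11)) y = 0 := if_neg fun h ↦ h k (by simpa using hk)
        rw [this, zero_mul]
      · simp [hy]
    · simp [hx])
  simpa using h

end SharplyFourTransitive

/-- Every sharply 4-transitive subgroup of `Sym(11)` (i.e. the Mathieu group
`M₁₁`) has the strict EKR property: every intersecting subset has size at most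
`720 = 7920/11`, and the intersecting subsets of size `720` are exactly the
cosets `S_{i,j} = {π ∈ G : π(i) = j}`. -/
theorem strict_ekr_sharply_four_transitive_degree_eleven
    (G : Subgroup (Equiv.Perm (Fin 11))) [Fintype G]
    (hsharp : ∀ a₁ a₂ a₃ a₄ b₁ b₂ b₃ b₄ : Fin 11,
      a₁ ≠ a₂ → a₁ ≠ a₃ → a₁ ≠ a₄ → a₂ ≠ a₃ → a₂ ≠ a₄ → a₃ ≠ a₄ →
      b₁ ≠ b₂ → b₁ ≠ b₃ → b₁ ≠ b₄ → b₂ ≠ b₃ → b₂ ≠ b₄ → b₃ ≠ b₄ →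
      ∃! g : G, (g : Equiv.Perm (Fin 11)) a₁ = b₁ ∧
        (g : Equiv.Perm (Fin 11)) a₂ = b₂ ∧
        (g : Equiv.Perm (Fin 11)) a₃ = b₃ ∧
        (g : Equiv.Perm (Fin 11)) a₄ = b₄) :
    ∀ S : Finset G,
      (∀ π ∈ S, ∀ σ ∈ S, ∃ x : Fin 11, ((π * σ⁻¹ : G) : Equiv.Perm (Fin 11)) x = x) →
      S.card ≤ 720 ∧
      (S.card = 720 → ∃ i j : Fin 11, S = Finset.univ.filter
        (fun g : G => (g : Equiv.Perm (Fin 11)) i = j)) := by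
  open SharplyFourTransitive in
  intro S hS
  have hG : IsSharp G := hsharp
  constructor
  · have h := ratio_bound_of_intersecting hG S hS
    have h₀ : 0 ≤ 308 / 3 * ∑ x, ((if x ∈ S then (1 : ℝ) else 0)
      - proj (fun x : G ↦ if x ∈ S then 1 else 0) x) ^ 2 := by positivity
    by_contra! hlt
    have hlt' : (720 : ℝ) < S.card := by exact_mod_cast hlt
    nlinarith
  · intro hcard
    obtain ⟨x, hx⟩ : S.Nonempty := by
      rw [← Finset.card_pos, hcard]; norm_num
    have hT : ∀ y, y ∈ S.map (Equiv.mulRight x⁻¹).toEmbedding ↔ y * x ∈ S := fun y ↦ by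
      simp [Finset.mem_map_equiv]
    have hTcard : (S.map (Equiv.mulRight x⁻¹).toEmbedding).card = 720 := by
      rw [Finset.card_map, hcard]
    generalize S.map (Equiv.mulRight x⁻¹).toEmbedding = T at hT hTcard
    have hTS : ∀ π ∈ T, ∀ σ ∈ T, ∃ k : Fin 11,
        ((π * σ⁻¹ : G) : Equiv.Perm (Fin 11)) k = k := fun π hπ σ hσ ↦ by
      simpa using hS _ ((hT π).1 hπ) _ ((hT σ).1 hσ)
    have h := ratio_bound_of_intersecting hG T hTS
    rw [hTcard] at h
    have h₀ : ∑ x, ((if x ∈ T then (1 : ℝ) else 0)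
        - proj (fun x : G ↦ if x ∈ T then 1 else 0) x) ^ 2 = 0 := by
      refine le_antisymm ?_ (Finset.sum_nonneg fun _ _ ↦ sq_nonneg _)
      norm_num at h
      linarith
    have h₁ : 1 ∈ T := (hT 1).2 (by simpa using hx)
    obtain ⟨i, hi⟩ := eq_filter_of_one_mem hG T h₁
      (fun y hy ↦ by simpa using hTS y hy 1 h₁) hTcard (fun y ↦ by
        rw [Finset.sum_eq_zero_iff_of_nonneg fun _ _ ↦ sq_nonneg _] at h₀
        exact sub_eq_zero.1 (pow_eq_zero_iff two_ne_zero |>.1 (h₀ y (Finset.mem_univ y))))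
    refine ⟨((x⁻¹ : G) : Equiv.Perm (Fin 11)) i, i, ?_⟩
    ext y
    have := hT (y * x⁻¹)
    rw [inv_mul_cancel_right] at this
    rw [← this, hi]
    simp
end
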